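/- Let m ≥ 2, n ≥ 2m+2, and let π = (d_1, …, d_n) be a non-increasing graphic sequence with σ(π) ≥ max{2n + 4m² − 2m − 2, m(2n − m − 1) + 2} + 2. Then π is potentially C_{2m+2}-graphic; moreover, π satisfies d_{2m+3−i} ≥ i+1 for every 1 ≤ i ≤ m, so π even has a realization containing cycles of every length r with 3 ≤ r ≤ 2m+2. -/

import Mathlib

/-- `G` contains a cycle of length `r`. -/
def hasCycleOfLength {V : Type*} (G : SimpleGraph V) (r : ℕ) : Prop :=
  ∃ (v : V) (c : G.Walk v v), c.IsCycle ∧ c.length = r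

/-- `G` is a realization of the sequence `d`, i.e. `d` is its degree sequence. -/
def IsDegreeSeq {n : ℕ} (G : SimpleGraph (Fin n)) (d : Fin n → ℕ) : Prop :=
  ∀ i, (G.neighborSet i).ncard = d i

/-- The sequence `d` is graphic: it is the degree sequence of a simple graph. -/
def Graphic {n : ℕ} (d : Fin n → ℕ) : Prop :=
  ∃ G : SimpleGraph (Fin n), IsDegreeSeq G d

/-- `d` is potentially ₃Cℓ-graphic: some realization contains cycles of every
length `r` with `3 ≤ r ≤ ℓ`. -/
def Pot3C {n : ℕ} (ℓ : ℕ) (d : Fin n → ℕ) : Prop :=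
  ∃ G : SimpleGraph (Fin n), IsDegreeSeq G d ∧ ∀ r, 3 ≤ r → r ≤ ℓ → hasCycleOfLength G r

/-- `d` is potentially Cℓ-graphic: some realization contains a cycle of length `ℓ`. -/
def PotC {n : ℕ} (ℓ : ℕ) (d : Fin n → ℕ) : Prop :=
  ∃ G : SimpleGraph (Fin n), IsDegreeSeq G d ∧ hasCycleOfLength G ℓ

/-- `d` has a realization `G` containing cycles `C₃, …, C_ℓ` on those vertices with
degrees `d 0, …, d (ℓ-1)`: the induced subgraph on some vertex set `S`, whose multiset
of degrees is that of the first `ℓ` terms of `d`, contains cycles of all lengths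
from `3` to `ℓ`. -/
def RealizationWithCyclesOn {n : ℕ} (ℓ : ℕ) (d : Fin n → ℕ) : Prop :=
  ∃ (G : SimpleGraph (Fin n)) (S : Finset (Fin n)),
    IsDegreeSeq G d ∧ S.card = ℓ ∧
    S.val.map d = (Finset.univ.filter (fun i : Fin n => (i : ℕ) < ℓ)).val.map d ∧
    ∀ r, 3 ≤ r → r ≤ ℓ → hasCycleOfLength (G.induce (S : Set (Fin n))) r

namespace DSeq
set_option linter.unusedSectionVars false
set_option linter.unusedVariables false
open Finset

section basics
variable {V : Type*} [Fintype V] [DecidableEq V]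

open Classical in
/-- Neighbour finset. -/
noncomputable def nb (G : SimpleGraph V) (v : V) : Finset V := univ.filter (fun w => G.Adj v w)

/-- Degree. -/
noncomputable def dg (G : SimpleGraph V) (v : V) : ℕ := (nb G v).card

theorem mem_nb {G : SimpleGraph V} {v w : V} : w ∈ nb G v ↔ G.Adj v w := by simp [nb]

/-- Two graphs have the same degrees. -/
def SameDeg (G G' : SimpleGraph V) : Prop := ∀ v, dg G v = dg G' v

theorem SameDeg.rfl' {G : SimpleGraph V} : SameDeg G G := fun _ => rfl
theorem SameDeg.tr {G G' G'' : SimpleGraph V} (h : SameDeg G G') (h' : SameDeg G' G'') :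
    SameDeg G G'' := fun v => (h v).trans (h' v)
theorem SameDeg.sy {G G' : SimpleGraph V} (h : SameDeg G G') : SameDeg G' G :=
  fun v => (h v).symm

theorem two_swap {G : SimpleGraph V} {a b c e : V} (hab : G.Adj a b) (hce : G.Adj c e)
    (hac : ¬ G.Adj a c) (hbe : ¬ G.Adj b e) (nac : a ≠ c) (nbe : b ≠ e) :
    ∃ G' : SimpleGraph V, SameDeg G G' ∧ G'.Adj a c ∧ G'.Adj b e ∧
      (∀ s t, G.Adj s t → s(s, t) ≠ s(a, b) → s(s, t) ≠ s(c, e) → G'.Adj s t) ∧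
      (∀ s t, G'.Adj s t → G.Adj s t ∨ s(s, t) = s(a, c) ∨ s(s, t) = s(b, e)) := by
  have n1 := hab.ne
  have n2 := hce.ne
  have n3 : a ≠ e := by rintro rfl; exact hbe hab.symm
  have n4 : b ≠ c := by rintro rfl; exact hac hab
  let G' : SimpleGraph V :=
    { Adj := fun s t => (G.Adj s t ∧ s(s, t) ≠ s(a, b) ∧ s(s, t) ≠ s(c, e)) ∨
        s(s, t) = s(a, c) ∨ s(s, t) = s(b, e)
      symm := ⟨fun s t h => by
        rw [Sym2.eq_swap (a := t) (b := s), G.adj_comm t s]; exact h⟩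
      loopless := ⟨fun s h => by
        rcases h with h | h | h
        · exact h.1.ne rfl
        · simp only [Sym2.eq_iff] at h; grind
        · simp only [Sym2.eq_iff] at h; grind⟩ }
  have hG' : ∀ s t, G'.Adj s t ↔ (G.Adj s t ∧ s(s, t) ≠ s(a, b) ∧ s(s, t) ≠ s(c, e)) ∨
        s(s, t) = s(a, c) ∨ s(s, t) = s(b, e) := fun s t => Iff.rfl
  have key : ∀ v x y, G.Adj v x → ¬ G.Adj v y → nb G' v = insert y ((nb G v).erase x) →
      dg G v = dg G' v := by
    intro v x y h1 h2 h3
    unfold dg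
    rw [h3, card_insert_of_notMem (by simp [mem_nb, h2]), card_erase_of_mem (mem_nb.2 h1)]
    have : 0 < (nb G v).card := card_pos.2 ⟨x, mem_nb.2 h1⟩
    omega
  refine ⟨G', ?_, Or.inr (Or.inl rfl), Or.inr (Or.inr rfl), fun s t h h1 h2 => Or.inl ⟨h, h1, h2⟩,
    fun s t h => ?_⟩
  · intro v
    by_cases va : v = a
    · subst va
      refine key v b c hab hac ?_
      ext t
      simp only [mem_nb, hG', mem_insert, mem_erase, Sym2.eq_iff]
      have := G.adj_comm
      grind
    by_cases vb : v = b
    · subst vb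
      refine key v a e hab.symm hbe ?_
      ext t
      simp only [mem_nb, hG', mem_insert, mem_erase, Sym2.eq_iff]
      grind
    by_cases vc : v = c
    · subst vc
      refine key v e a hce (fun h => hac h.symm) ?_
      ext t
      simp only [mem_nb, hG', mem_insert, mem_erase, Sym2.eq_iff]
      grind
    by_cases ve : v = e
    · subst ve
      refine key v c b hce.symm (fun h => hbe h.symm) ?_
      ext t
      simp only [mem_nb, hG', mem_insert, mem_erase, Sym2.eq_iff]
      grind
    · unfold dg
      congr 1
      ext t
      simp only [mem_nb, hG', Sym2.eq_iff]
      grind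
  · rw [hG'] at h
    rcases h with h | h
    · exact Or.inl h.1
    · exact Or.inr h

/-- Isolate a vertex. -/
def del (G : SimpleGraph V) (x : V) : SimpleGraph V where
  Adj s t := G.Adj s t ∧ s ≠ x ∧ t ≠ x
  symm := ⟨fun _ _ h => ⟨h.1.symm, h.2.2, h.2.1⟩⟩
  loopless := ⟨fun _ h => h.1.ne rfl⟩

theorem nb_del {G : SimpleGraph V} {x v : V} (h : v ≠ x) : nb (del G x) v = (nb G v).erase x := by
  ext t
  simp only [mem_nb, del, mem_erase]
  tauto

theorem dg_del_self {G : SimpleGraph V} {x : V} : dg (del G x) x = 0 := by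
  simp only [dg, card_eq_zero]
  ext t
  simp [mem_nb, del]

theorem dg_del_of_adj {G : SimpleGraph V} {x v : V} (h : G.Adj x v) :
    dg (del G x) v + 1 = dg G v := by
  unfold dg
  rw [nb_del h.ne']
  exact card_erase_add_one (mem_nb.2 h.symm)

theorem dg_del_of_not_adj {G : SimpleGraph V} {x v : V} (hv : v ≠ x) (h : ¬ G.Adj x v) :
    dg (del G x) v = dg G v := by
  unfold dg
  rw [nb_del hv, erase_eq_of_notMem]
  rw [mem_nb]
  exact fun h' => h h'.symm

theorem dg_eq_zero {G : SimpleGraph V} {v : V} : dg G v = 0 ↔ ∀ w, ¬ G.Adj v w := by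
  simp [dg, Finset.eq_empty_iff_forall_notMem, mem_nb]

theorem dg_pos {G : SimpleGraph V} {v : V} : 0 < dg G v ↔ ∃ w, G.Adj v w := by
  rw [Nat.pos_iff_ne_zero, Ne, dg_eq_zero]; push Not; rfl

theorem recombine {G F' : SimpleGraph V} {x : V} (h : SameDeg (del G x) F') :
    ∃ G', SameDeg G G' ∧ F' ≤ G' ∧ ∀ w, G.Adj x w → G'.Adj x w := by
  have hx : ∀ w, ¬ F'.Adj x w := dg_eq_zero.1 ((h x).symm.trans dg_del_self)
  let G' : SimpleGraph V :=
    { Adj := fun s t => F'.Adj s t ∨ (G.Adj s t ∧ (s = x ∨ t = x))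
      symm := ⟨fun s t h => by rw [F'.adj_comm, G.adj_comm, or_comm (a := t = x)]; exact h⟩
      loopless := ⟨fun s h => by
        rcases h with h | h
        · exact h.ne rfl
        · exact h.1.ne rfl⟩ }
  have hG' : ∀ s t, G'.Adj s t ↔ F'.Adj s t ∨ (G.Adj s t ∧ (s = x ∨ t = x)) := fun _ _ => Iff.rfl
  refine ⟨G', ?_, fun s t h => Or.inl h, fun w hw => Or.inr ⟨hw, Or.inl rfl⟩⟩
  intro v
  by_cases hv : v = x
  · subst hv
    unfold dg
    congr 1
    ext t
    simp [mem_nb, hG', hx]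
  · by_cases ha : G.Adj x v
    · rw [← dg_del_of_adj ha, h v]
      unfold dg
      have : nb G' v = insert x (nb F' v) := by
        ext t
        simp only [mem_nb, hG', mem_insert]
        have := ha.symm
        grind
      rw [this, card_insert_of_notMem]
      rw [mem_nb]
      exact fun h' => hx _ h'.symm
    · rw [← dg_del_of_not_adj hv ha, h v]
      unfold dg
      congr 1
      ext t
      simp only [mem_nb, hG']
      have := G.adj_comm x v
      grind

theorem kleitman_wang {G : SimpleGraph V} {x : V} {T : Finset V} (hx : x ∉ T)
    (hT : T.card = dg G x) (htop : ∀ t ∈ T, ∀ u, u ∉ T → u ≠ x → dg G u ≤ dg G t) :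
    ∃ F, SameDeg G F ∧ nb F x = T := by
  classical
  have hne : ∃ k F, SameDeg G F ∧ (nb F x ∩ T).card = k := ⟨_, G, SameDeg.rfl', rfl⟩
  have hb : ∀ k, (∃ F, SameDeg G F ∧ (nb F x ∩ T).card = k) → k ≤ T.card := by
    rintro k ⟨F, -, rfl⟩
    exact card_le_card inter_subset_right
  obtain ⟨k, hk⟩ := hne
  have hs := Nat.findGreatest_spec (P := fun k => ∃ F, SameDeg G F ∧ (nb F x ∩ T).card = k)
    (hb k hk) hk
  obtain ⟨F, hF, hFk⟩ := hs
  refine ⟨F, hF, ?_⟩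
  by_contra hcon
  have hcard : (nb F x).card = T.card := by rw [hT]; exact (hF x).symm
  have h1 : ∃ t ∈ T, t ∉ nb F x := by
    by_contra hh
    push Not at hh
    exact hcon (eq_of_subset_of_card_le hh hcard.le).symm
  have h2 : ∃ u ∈ nb F x, u ∉ T := by
    by_contra hh
    push Not at hh
    exact hcon (eq_of_subset_of_card_le hh hcard.ge)
  obtain ⟨t, ht, htx⟩ := h1
  obtain ⟨u, hu, huT⟩ := h2
  rw [mem_nb] at htx hu
  have htx' : t ≠ x := by rintro rfl; exact hx ht
  have hut : u ≠ t := by rintro rfl; exact huT ht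
  have hd : dg F u ≤ dg F t := by
    rw [← hF u, ← hF t]; exact htop t ht u huT hu.ne'
  have h3 : ∃ z, F.Adj t z ∧ ¬ F.Adj u z ∧ z ≠ u := by
    by_contra hh
    push Not at hh
    have hsub : (nb F t).erase u ⊂ (nb F u).erase t := by
      refine (ssubset_iff_of_subset ?_).2 ⟨x, ?_, ?_⟩
      · intro z hz
        simp only [mem_erase, mem_nb] at hz ⊢
        exact ⟨hz.2.ne', by by_contra h; exact hz.1 (hh z hz.2 h)⟩
      · simp only [mem_erase, mem_nb]; exact ⟨htx'.symm, hu.symm⟩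
      · simp only [mem_erase, mem_nb]; exact fun h => htx h.2.symm
    have hlt := card_lt_card hsub
    simp only [card_erase_eq_ite, mem_nb, F.adj_comm t u] at hlt
    unfold dg at hd
    split_ifs at hlt <;> omega
  obtain ⟨z, hz1, hz2, hz3⟩ := h3
  obtain ⟨F', hF', hA, hB, hC, hD⟩ := two_swap hu hz1 htx hz2 htx'.symm hz3.symm
  have hlt : (nb F x ∩ T).card < (nb F' x ∩ T).card := by
    apply card_lt_card
    refine (ssubset_iff_of_subset ?_).2 ⟨t, ?_, ?_⟩
    · intro s hs
      simp only [mem_inter, mem_nb] at hs ⊢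
      refine ⟨hC _ _ hs.1 ?_ ?_, hs.2⟩
      · simp only [Ne, Sym2.eq_iff]; grind
      · simp only [Ne, Sym2.eq_iff]; have := hs.1.ne; grind
    · simp [mem_nb, hA, ht]
    · simp [mem_nb, htx]
  have := Nat.le_findGreatest (P := fun k => ∃ F, SameDeg G F ∧ (nb F x ∩ T).card = k)
    (hb _ ⟨F', hF.tr hF', rfl⟩) ⟨F', hF.tr hF', rfl⟩
  omega

theorem exists_top (f : V → ℕ) (A : Finset V) (k : ℕ) (hk : k ≤ A.card) :
    ∃ T ⊆ A, T.card = k ∧ ∀ t ∈ T, ∀ u ∈ A, u ∉ T → f u ≤ f t := by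
  induction k with
  | zero => exact ⟨∅, by simp, by simp, by simp⟩
  | succ k ih =>
    obtain ⟨T, hTA, hTk, hT⟩ := ih (by omega)
    have hne : (A \ T).Nonempty := by
      rw [← card_pos, card_sdiff_of_subset hTA]; omega
    obtain ⟨y, hy, hmax⟩ := exists_max_image (A \ T) f hne
    simp only [mem_sdiff] at hy hmax
    refine ⟨insert y T, insert_subset hy.1 hTA, by rw [card_insert_of_notMem hy.2, hTk], ?_⟩
    intro t ht u hu huT
    rw [mem_insert] at ht huT
    push Not at huT
    rcases ht with rfl | ht
    · exact hmax u ⟨hu, huT.2⟩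
    · exact hT t ht u hu huT.2

end basics
end DSeq

namespace DSeq
set_option linter.unusedSectionVars false
set_option linter.unusedVariables false
open Finset
section cycles
variable {V : Type*} [Fintype V] [DecidableEq V]

/-- `P` is a path in `G` from `p` to `q`, as a list of vertices. -/
structure Pth (G : SimpleGraph V) (P : List V) (p q : V) : Prop where
  ch : P.IsChain G.Adj
  nd : P.Nodup
  hd : P.head? = some p
  lt : P.getLast? = some q

theorem Pth.cons {G : SimpleGraph V} {P : List V} {p q a : V} (h : Pth G P p q) (ha : G.Adj a p)
    (hP : a ∉ P) : Pth G (a :: P) a q where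
  ch := by
    rw [List.isChain_cons]
    refine ⟨fun y hy => ?_, h.ch⟩
    rw [h.hd] at hy
    simp at hy
    exact hy ▸ ha
  nd := List.nodup_cons.2 ⟨hP, h.nd⟩
  hd := rfl
  lt := by simp [List.getLast?_cons, h.lt]

theorem Pth.mono {G G' : SimpleGraph V} {P : List V} {p q : V} (h : Pth G P p q)
    (hG : ∀ s ∈ P, ∀ t ∈ P, G.Adj s t → G'.Adj s t) : Pth G' P p q where
  ch := List.IsChain.imp_of_mem_imp (fun a b ha hb => hG a ha b hb) h.ch
  nd := h.nd
  hd := h.hd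
  lt := h.lt

theorem Pth.rev {G : SimpleGraph V} {P : List V} {p q : V} (h : Pth G P p q) :
    Pth G P.reverse q p where
  ch := by
    rw [List.isChain_reverse]
    exact h.ch.imp (fun a b hab => hab.symm)
  nd := List.nodup_reverse.2 h.nd
  hd := by rw [List.head?_reverse, h.lt]
  lt := by rw [List.getLast?_reverse, h.hd]

theorem Pth.single {G : SimpleGraph V} (p : V) : Pth G [p] p p := ⟨by simp, by simp, rfl, rfl⟩

theorem Pth.mem_hd {G : SimpleGraph V} {P : List V} {p q : V} (h : Pth G P p q) : p ∈ P :=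
  List.mem_of_mem_head? h.hd
theorem Pth.mem_lt {G : SimpleGraph V} {P : List V} {p q : V} (h : Pth G P p q) : q ∈ P :=
  List.mem_of_getLast? h.lt

/-- joining two paths -/
theorem Pth.append {G : SimpleGraph V} {P Q : List V} {p q a b : V} (h : Pth G P p q)
    (h' : Pth G Q a b) (hqa : G.Adj q a) (hd : ∀ x ∈ P, x ∉ Q) : Pth G (P ++ Q) p b where
  ch := by
    rw [List.isChain_append]
    refine ⟨h.ch, h'.ch, ?_⟩
    intro x hx y hy
    rw [h.lt] at hx
    rw [h'.hd] at hy
    simp at hx hy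
    rw [← hx, ← hy]; exact hqa
  nd := by
    rw [List.nodup_append]
    refine ⟨h.nd, h'.nd, ?_⟩
    intro a ha b hb hab
    exact hd a ha (hab ▸ hb)
  hd := by simp [List.head?_append, h.hd]
  lt := by simp [List.getLast?_append, h'.lt]

/-- A cycle through `u`, with cycle neighbours `p,q`, rest `P`, vertex set `S`. -/
structure CycAt (G : SimpleGraph V) (S : Finset V) (u p q : V) (P : List V) : Prop where
  pth : Pth G P p q
  nu : u ∉ P
  ne : p ≠ q
  up : G.Adj u p
  uq : G.Adj u q
  eqS : insert u P.toFinset = S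

/-- `G` has a cycle with vertex set `S`. -/
def HasCyc (G : SimpleGraph V) (S : Finset V) : Prop := ∃ u p q P, CycAt G S u p q P

theorem CycAt.hc {G : SimpleGraph V} {S : Finset V} {u p q : V} {P : List V}
    (h : CycAt G S u p q P) : HasCyc G S := ⟨u, p, q, P, h⟩

theorem CycAt.memu {G : SimpleGraph V} {S : Finset V} {u p q : V} {P : List V}
    (h : CycAt G S u p q P) : u ∈ S := by rw [← h.eqS]; simp
theorem CycAt.memP {G : SimpleGraph V} {S : Finset V} {u p q : V} {P : List V}
    (h : CycAt G S u p q P) {x : V} (hx : x ∈ P) : x ∈ S := by rw [← h.eqS]; simp [hx]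
theorem CycAt.memp {G : SimpleGraph V} {S : Finset V} {u p q : V} {P : List V}
    (h : CycAt G S u p q P) : p ∈ S := h.memP h.pth.mem_hd
theorem CycAt.memq {G : SimpleGraph V} {S : Finset V} {u p q : V} {P : List V}
    (h : CycAt G S u p q P) : q ∈ S := h.memP h.pth.mem_lt
theorem CycAt.mem_iff {G : SimpleGraph V} {S : Finset V} {u p q : V} {P : List V}
    (h : CycAt G S u p q P) {x : V} : x ∈ S ↔ x = u ∨ x ∈ P := by rw [← h.eqS]; simp
theorem CycAt.card {G : SimpleGraph V} {S : Finset V} {u p q : V} {P : List V}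
    (h : CycAt G S u p q P) : S.card = P.length + 1 := by
  rw [← h.eqS, card_insert_of_notMem (by simpa using h.nu),
    List.toFinset_card_of_nodup h.pth.nd]

theorem CycAt.card3 {G : SimpleGraph V} {S : Finset V} {u p q : V} {P : List V}
    (h : CycAt G S u p q P) : 3 ≤ S.card := by
  have : ({u, p, q} : Finset V) ⊆ S := by
    intro x hx
    simp only [mem_insert, mem_singleton] at hx
    rcases hx with rfl | rfl | rfl
    · exact h.memu
    · exact h.memp
    · exact h.memq
  have h2 := card_le_card this
  rw [card_eq_three.2 ⟨u, p, q, h.up.ne, h.uq.ne, h.ne, rfl⟩] at h2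
  exact h2

theorem HasCyc.card3 {G : SimpleGraph V} {S : Finset V} (h : HasCyc G S) : 3 ≤ S.card := by
  obtain ⟨_, _, _, _, h⟩ := h
  exact h.card3

theorem CycAt.rev {G : SimpleGraph V} {S : Finset V} {u p q : V} {P : List V}
    (h : CycAt G S u p q P) : CycAt G S u q p P.reverse :=
  ⟨h.pth.rev, by simpa using h.nu, h.ne.symm, h.uq, h.up, by simpa using h.eqS⟩

/-- change the graph -/
theorem CycAt.mono {G G' : SimpleGraph V} {S : Finset V} {u p q : V} {P : List V}
    (h : CycAt G S u p q P) (hG : ∀ s ∈ P, ∀ t ∈ P, G.Adj s t → G'.Adj s t)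
    (hp : G'.Adj u p) (hq : G'.Adj u q) : CycAt G' S u p q P :=
  ⟨h.pth.mono hG, h.nu, h.ne, hp, hq, h.eqS⟩

theorem HasCyc.mono {G G' : SimpleGraph V} {S : Finset V} (h : HasCyc G S) (hG : G ≤ G') :
    HasCyc G' S := by
  obtain ⟨u, p, q, P, h⟩ := h
  exact ⟨u, p, q, P, h.mono (fun s _ t _ hst => hG hst) (hG h.up) (hG h.uq)⟩

/-- replace `u` by `b` -/
theorem CycAt.repl {G G' : SimpleGraph V} {S : Finset V} {u p q b : V} {P : List V}
    (h : CycAt G S u p q P) (hG : ∀ s ∈ P, ∀ t ∈ P, G.Adj s t → G'.Adj s t)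
    (hb : b ∉ S) (hp : G'.Adj b p) (hq : G'.Adj b q) :
    CycAt G' (insert b (S.erase u)) b p q P := by
  refine ⟨h.pth.mono hG, fun hbP => hb (h.memP hbP), h.ne, hp, hq, ?_⟩
  congr 1
  rw [← h.eqS, erase_insert (by simpa using h.nu)]

/-- insert `b` between `u` and `p` -/
theorem CycAt.ins {G G' : SimpleGraph V} {S : Finset V} {u p q b : V} {P : List V}
    (h : CycAt G S u p q P) (hG : ∀ s ∈ P, ∀ t ∈ P, G.Adj s t → G'.Adj s t)
    (hb : b ∉ S) (hp : G'.Adj b p) (hu : G'.Adj u b) (hq : G'.Adj u q) :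
    CycAt G' (insert b S) u b q (b :: P) := by
  have hbP : b ∉ P := fun hbP => hb (h.memP hbP)
  refine ⟨(h.pth.mono hG).cons hp hbP, ?_, ?_, hu, hq, ?_⟩
  · simp only [List.mem_cons, not_or]
    exact ⟨hu.ne, h.nu⟩
  · rintro rfl; exact hb h.memq
  · rw [← h.eqS]; ext x; simp; tauto

theorem Pth.len_of_ne {G : SimpleGraph V} {P : List V} {p q : V} (h : Pth G P p q) (hpq : p ≠ q) :
    2 ≤ P.length := by
  rcases P with _ | ⟨a, _ | ⟨b, P⟩⟩
  · have := h.hd; simp at this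
  · have h1 := h.hd; have h2 := h.lt; simp at h1 h2; exact absurd (h1.symm.trans h2) hpq
  · simp

theorem Pth.ne_of_len {G : SimpleGraph V} {P : List V} {p q : V} (h : Pth G P p q)
    (h2 : 2 ≤ P.length) : p ≠ q := by
  rintro rfl
  rcases P with _ | ⟨a, _ | ⟨b, P⟩⟩
  · simp at h2
  · simp at h2
  · have h1 := h.hd
    simp at h1
    subst h1
    have h3 := h.nd
    have h4 := h.lt
    rw [List.getLast?_cons_cons] at h4
    exact (List.nodup_cons.1 h3).1 (List.mem_of_getLast? h4)

theorem CycAt.rotate {G : SimpleGraph V} {S : Finset V} {u p q w : V} {A B : List V}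
    (h : CycAt G S u p q (A ++ w :: B)) :
    ∃ p' q', CycAt G S w p' q' (B ++ u :: A) ∧ p' ∈ (B ++ [u]).head? := by
  obtain ⟨p', hp'⟩ : ∃ p', (B ++ [u]).head? = some p' := by cases B <;> simp
  obtain ⟨q', hq'⟩ : ∃ q', (u :: A).getLast? = some q' := by
    exact ⟨_, List.getLast?_eq_some_getLast (by simp)⟩
  have hch := h.pth.ch
  have hnd := h.pth.nd
  have hnu := h.nu
  have hhd := h.pth.hd
  have hlt := h.pth.lt
  have hlen := h.pth.len_of_ne h.ne
  have hP : Pth G (B ++ u :: A) p' q' := by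
    constructor
    · rw [List.isChain_append] at hch ⊢
      obtain ⟨h1, h2, h3⟩ := hch
      rw [List.isChain_cons] at h2
      refine ⟨h2.2, ?_, ?_⟩
      · rw [List.isChain_cons]
        refine ⟨?_, h1⟩
        intro y hy
        rw [List.head?_append] at hhd
        simp only [Option.mem_def] at hy
        rw [hy] at hhd
        simp at hhd
        exact hhd ▸ h.up
      · intro x hx y hy
        simp at hx hy
        rw [List.getLast?_append, List.getLast?_cons, hx] at hlt
        simp at hlt
        subst hlt; subst hy
        exact h.uq.symm
    · rw [List.nodup_append, List.nodup_cons] at hnd ⊢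
      simp only [List.mem_append, List.mem_cons, not_or] at hnu
      simp only [List.mem_cons] at hnd ⊢
      grind
    · rw [← hp']; cases B <;> simp
    · rw [List.getLast?_append, hq']; rfl
  have hwA : w ∉ A ∧ w ∉ B := by
    rw [List.nodup_append, List.nodup_cons] at hnd
    grind
  have hwu : w ≠ u := by rintro rfl; simp at hnu
  refine ⟨p', q', ⟨hP, ?_, ?_, ?_, ?_, ?_⟩, hp'⟩
  · simp [hwA.1, hwA.2, hwu]
  · apply hP.ne_of_len
    simp at hlen ⊢; omega
  · rw [List.isChain_append, List.isChain_cons] at hch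
    rcases B with _ | ⟨b, B⟩
    · simp at hp' hlt; subst hp'; subst hlt; exact h.uq.symm
    · simp at hp'; subst hp'; exact hch.2.1.1 _ rfl
  · rw [List.isChain_append] at hch
    rcases A.eq_nil_or_concat with rfl | ⟨A', a, rfl⟩
    · simp at hq' hhd; subst hq'; subst hhd; exact h.up.symm
    · have : q' = a := by
        rw [List.concat_eq_append, ← List.cons_append, List.getLast?_append] at hq'
        simpa using hq'.symm
      subst this
      exact (hch.2.2 q' (by simp) w (by simp)).symm
  · rw [← h.eqS]
    ext x
    simp
    tauto

theorem CycAt.at {G : SimpleGraph V} {S : Finset V} {u p q w : V} {P : List V}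
    (h : CycAt G S u p q P) (hw : w ∈ S) : ∃ p' q' P', CycAt G S w p' q' P' := by
  rcases h.mem_iff.1 hw with rfl | hw
  · exact ⟨_, _, _, h⟩
  · obtain ⟨A, B, rfl⟩ := List.append_of_mem hw
    obtain ⟨p', q', h', -⟩ := h.rotate
    exact ⟨_, _, _, h'⟩

theorem HasCyc.at {G : SimpleGraph V} {S : Finset V} {w : V}
    (h : HasCyc G S) (hw : w ∈ S) : ∃ p' q' P', CycAt G S w p' q' P' := by
  obtain ⟨u, p, q, P, h⟩ := h
  exact h.at hw

theorem CycAt.shift {G : SimpleGraph V} {S : Finset V} {u p q : V} {P : List V}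
    (h : CycAt G S u p q P) : ∃ p2 P', CycAt G S p u p2 P' := by
  obtain ⟨B, rfl⟩ : ∃ B, P = p :: B := List.head?_eq_some_iff.1 h.pth.hd
  obtain ⟨p', q', h', -⟩ := CycAt.rotate (A := []) (B := B) h
  have : q' = u := by have := h'.pth.lt; simpa using this.symm
  subst this
  exact ⟨_, _, h'.rev⟩

theorem count_chain (A : V → Prop) [DecidablePred A] (a b : V) (L : List V)
    (hch : L.IsChain (fun s t => ¬ (A s ∧ A t))) (hL : L.head? = some a)
    (hb : L.getLast? = some b) :
    2 * L.countP A + 1 ≤ L.length + (if A a then 1 else 0) + (if A b then 1 else 0) := by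
  induction L generalizing a with
  | nil => simp at hL
  | cons x L ih =>
    simp at hL
    subst hL
    rcases L with _ | ⟨y, L⟩
    · simp at hb
      subst hb
      by_cases h : A x <;> simp [h]
    · have h1 := ih y (List.isChain_cons_cons.1 hch).2 rfl (by simpa [List.getLast?_cons_cons] using hb)
      have h2 := (List.isChain_cons_cons.1 hch).1
      rw [List.countP_cons]
      rw [List.length_cons]
      by_cases hx : A x <;> by_cases hy : A y <;> simp [hx, hy] at h1 h2 ⊢ <;> omega

theorem countP_eq_card (A : V → Prop) [DecidablePred A] (L : List V) (hL : L.Nodup) :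
    L.countP A = (L.toFinset.filter A).card := by
  rw [List.countP_eq_length_filter, ← List.toFinset_card_of_nodup (hL.filter _)]
  congr 1
  ext x
  simp

/-- no consecutive pair in A -/
theorem noconsec_chain {G : SimpleGraph V} {S : Finset V} {A : V → Prop}
    (hno : ∀ u p q P, CycAt G S u p q P → A u → ¬ A p) {u p q : V} {P : List V}
    (h : CycAt G S u p q P) : P.IsChain (fun s t => ¬ (A s ∧ A t)) := by
  rw [List.isChain_iff_forall_rel_of_append_cons_cons]
  rintro s t l₁ l₂ rfl
  obtain ⟨p', q', h', hp'⟩ := CycAt.rotate (A := l₁) (w := s) (B := t :: l₂) h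
  simp at hp'
  subst hp'
  exact fun hh => hno _ _ _ _ h' hh.1 hh.2

theorem noconsec_card {G : SimpleGraph V} {S : Finset V} {A : V → Prop} [DecidablePred A]
    (hno : ∀ u p q P, CycAt G S u p q P → A u → ¬ A p) (hS : HasCyc G S) :
    2 * (S.filter A).card ≤ S.card := by
  by_cases hne : ∃ u ∈ S, A u
  · obtain ⟨u, hu, hAu⟩ := hne
    obtain ⟨p, q, P, h⟩ := hS.at hu
    have h1 := hno _ _ _ _ h hAu
    have h2 := hno _ _ _ _ h.rev hAu
    have h3 := count_chain A p q P (noconsec_chain hno h) h.pth.hd h.pth.lt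
    simp only [h1, h2, if_false] at h3
    rw [countP_eq_card _ _ h.pth.nd] at h3
    have h4 := h.card
    have h5 : (S.filter A).card = (P.toFinset.filter A).card + 1 := by
      rw [← h.eqS, filter_insert, if_pos hAu, card_insert_of_notMem]
      simp [h.nu]
    omega
  · have : S.filter A = ∅ := by
      push Not at hne
      exact filter_eq_empty_iff.2 (fun x hx => hne x hx)
    rw [this]; simp

theorem noconsec_card' {G : SimpleGraph V} {S : Finset V} {A : V → Prop} [DecidablePred A]
    (hno : ∀ u p q P, CycAt G S u p q P → A u → ¬ A p) {u p q P} (h : CycAt G S u p q P)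
    (hu : ¬ A u) (hp : ¬ A p) :
    2 * (S.filter A).card + 1 ≤ S.card := by
  have h3 := count_chain A p q P (noconsec_chain hno h) h.pth.hd h.pth.lt
  simp only [hp, if_false] at h3
  rw [countP_eq_card _ _ h.pth.nd] at h3
  have h4 := h.card
  have h5 : (S.filter A).card = (P.toFinset.filter A).card := by
    rw [← h.eqS, filter_insert, if_neg hu]
  split_ifs at h3 <;> omega

theorem pigeon {G : SimpleGraph V} {S : Finset V} {A : V → Prop} [DecidablePred A]
    (hS : HasCyc G S) (hc : S.card < 2 * (S.filter A).card) :
    ∃ u p q P, CycAt G S u p q P ∧ A u ∧ A p := by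
  by_contra hcon
  have := noconsec_card (A := A) (fun u p q P h hu hp => hcon ⟨u, p, q, P, h, hu, hp⟩) hS
  omega

theorem hasCycleOfLength_of_pth {G : SimpleGraph V} {u p q : V} {P : List V}
    (h : Pth G P p q) (hu : u ∉ P) (hpq : p ≠ q) (hup : G.Adj u p) (huq : G.Adj u q) :
    hasCycleOfLength G (P.length + 1) := by
  have hne : P ≠ [] := by rintro rfl; simpa using h.hd
  have h1 : P.head hne = p := by
    have := h.hd; rw [List.head?_eq_some_head hne] at this; simpa using this
  have h2 : P.getLast hne = q := by
    have := h.lt; rw [List.getLast?_eq_some_getLast hne] at this; simpa using this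
  obtain ⟨w, hw1, hw2⟩ : ∃ w : G.Walk p q, w.support = P ∧ w.length = P.length - 1 := by
    subst h1; subst h2
    exact ⟨SimpleGraph.Walk.ofSupport P hne h.ch, SimpleGraph.Walk.support_ofSupport _ _,
      SimpleGraph.Walk.length_ofSupport _ _⟩
  have hp : w.IsPath := by rw [SimpleGraph.Walk.isPath_def, hw1]; exact h.nd
  refine ⟨u, SimpleGraph.Walk.cons hup (w.concat huq.symm), ?_, ?_⟩
  · rw [SimpleGraph.Walk.cons_isCycle_iff]
    refine ⟨hp.concat (by rw [hw1]; exact hu) _, ?_⟩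
    rw [SimpleGraph.Walk.edges_concat]
    simp only [List.concat_eq_append, List.mem_append, List.mem_singleton, not_or]
    refine ⟨fun hh => hu ?_, ?_⟩
    · rw [← hw1]; exact SimpleGraph.Walk.fst_mem_support_of_mem_edges _ hh
    · simp only [Sym2.eq_iff]
      have := hup.ne
      have := huq.ne
      grind
  · rw [SimpleGraph.Walk.length_cons, SimpleGraph.Walk.length_concat, hw2]
    have := List.length_pos_iff.2 hne
    omega

/-- indexing a cycle by naturals -/
theorem CycAt.fn {G : SimpleGraph V} {S : Finset V} {u p q : V} {P : List V}
    (h : CycAt G S u p q P) : ∃ f : ℕ → V, (∀ i, G.Adj (f i) (f (i + 1))) ∧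
      (∀ i j, f i = f j → i % S.card = j % S.card) ∧ (∀ i, f (i % S.card) = f i) ∧
      (∀ i, f i ∈ S) ∧ (∀ v ∈ S, ∃ i < S.card, f i = v) ∧ f 0 = u := by
  have hN : S.card = (u :: P).length := by rw [h.card]; rfl
  have hpos : 0 < (u :: P).length := by simp
  have hnd : (u :: P).Nodup := List.nodup_cons.2 ⟨h.nu, h.pth.nd⟩
  have hch : (u :: P).IsChain G.Adj := by
    rw [List.isChain_cons]
    refine ⟨?_, h.pth.ch⟩
    intro y hy
    rw [h.pth.hd] at hy
    simp at hy; exact hy ▸ h.up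
  rw [hN]
  refine ⟨fun i => (u :: P)[i % (u :: P).length]'(Nat.mod_lt _ hpos), ?_, ?_, ?_, ?_, ?_, ?_⟩
  · intro i
    have hlt := Nat.mod_lt i hpos
    by_cases hi : i % (u :: P).length + 1 < (u :: P).length
    · have h1 : (i + 1) % (u :: P).length = i % (u :: P).length + 1 := by
        rw [Nat.add_mod, Nat.mod_eq_of_lt (a := 1) (by simp [List.length_cons] at hi ⊢; omega)]
        exact Nat.mod_eq_of_lt hi
      simp only [h1]
      exact List.isChain_iff_getElem.1 hch _ hi
    · have h0 : i % (u :: P).length = (u :: P).length - 1 := by omega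
      have h1 : (i + 1) % (u :: P).length = 0 := by
        rw [← Nat.mod_add_mod, h0, Nat.sub_add_cancel hpos, Nat.mod_self]
      simp only [h1, h0]
      have h2 := h.pth.lt
      have h3 : (u :: P)[(u :: P).length - 1]'(by omega) = q := by
        have : (u :: P).getLast? = some q := by simp [List.getLast?_cons, h2]
        rw [List.getLast?_eq_some_getLast (by simp)] at this
        rw [List.getLast_eq_getElem] at this
        simpa using this
      rw [h3]
      exact h.uq.symm
  · intro i j hij
    exact (List.Nodup.getElem_inj_iff hnd).1 hij
  · intro i
    simp
  · intro i
    rw [← h.eqS, ← List.toFinset_cons, List.mem_toFinset]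
    exact List.getElem_mem _
  · intro v hv
    rw [← h.eqS, ← List.toFinset_cons, List.mem_toFinset] at hv
    obtain ⟨i, hi, rfl⟩ := List.getElem_of_mem hv
    exact ⟨i, hi, by simp only [Nat.mod_eq_of_lt hi]⟩
  · simp

/-- segments of an indexed path -/
theorem seg {G : SimpleGraph V} (f : ℕ → V) (i k : ℕ)
    (hadj : ∀ j, i ≤ j → j < i + k → G.Adj (f j) (f (j + 1)))
    (hinj : ∀ j j', i ≤ j → j ≤ i + k → i ≤ j' → j' ≤ i + k → f j = f j' → j = j') :
    Pth G ((List.range (k + 1)).map (fun j => f (i + j))) (f i) (f (i + k)) where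
  ch := by
    rw [List.isChain_map, List.isChain_range]
    intro j hj
    exact hadj (i + j) (by omega) (by omega)
  nd := by
    rw [List.nodup_map_iff_inj_on List.nodup_range]
    intro x hx y hy hxy
    rw [List.mem_range] at hx hy
    have := hinj (i + x) (i + y) (by omega) (by omega) (by omega) (by omega) hxy
    omega
  hd := by simp [List.head?_range]
  lt := by simp [List.getLast?_range]

theorem wheel {G : SimpleGraph V} {S : Finset V} {x : V} (hS : HasCyc G S) (hx : x ∉ S)
    (hc : S.card < 2 * (nb G x ∩ S).card) {r : ℕ} (hr : 3 ≤ r) (hr' : r ≤ S.card + 1) :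
    hasCycleOfLength G r := by
  classical
  obtain ⟨u, p, q, P, h⟩ := hS
  have h3 := h.card3
  obtain ⟨f, hf1, hf2, hf3, hf4, hf5, -⟩ := h.fn
  set N := S.card with hN
  let A := (range N).filter (fun i => G.Adj x (f i))
  have hA : A.card = (nb G x ∩ S).card := by
    apply card_bij (fun i _ => f i)
    · intro i hi
      simp only [A, mem_filter] at hi
      simp [mem_nb, hi.2, hf4]
    · intro i hi j hj hij
      simp only [A, mem_filter, mem_range] at hi hj
      have := hf2 i j hij
      rwa [Nat.mod_eq_of_lt hi.1, Nat.mod_eq_of_lt hj.1] at this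
    · intro v hv
      simp only [mem_inter, mem_nb] at hv
      obtain ⟨i, hi, rfl⟩ := hf5 v hv.2
      exact ⟨i, by simp [A, hi, hv.1], rfl⟩
  let B := (range N).filter (fun i => G.Adj x (f (i + (r - 2))))
  have hB : A.card ≤ B.card := by
    apply card_le_card_of_injOn (fun i => (i + (N - (r - 2))) % N)
    · intro i hi
      simp only [A, coe_filter, mem_range, Set.mem_ofPred_eq] at hi
      simp only [B, coe_filter, mem_range, Set.mem_ofPred_eq]
      refine ⟨Nat.mod_lt _ (by omega), ?_⟩
      have : ((i + (N - (r - 2))) % N + (r - 2)) % N = i := by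
        rw [Nat.mod_add_mod]
        have : i + (N - (r - 2)) + (r - 2) = i + N := by omega
        rw [this, Nat.add_mod_right, Nat.mod_eq_of_lt hi.1]
      rw [← hf3, this]
      exact hi.2
    · intro i hi j hj hij
      simp only [A, coe_filter, mem_range, Set.mem_ofPred_eq] at hi hj
      have : i ≡ j [MOD N] := Nat.ModEq.add_right_cancel' _ hij
      rw [Nat.ModEq, Nat.mod_eq_of_lt hi.1, Nat.mod_eq_of_lt hj.1] at this
      exact this
  have hAB : (A ∩ B).Nonempty := by
    rw [← card_pos]
    have h1 := card_union_add_card_inter A B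
    have h2 : (A ∪ B).card ≤ N := by
      have : A ∪ B ⊆ range N := union_subset (filter_subset _ _) (filter_subset _ _)
      simpa using card_le_card this
    omega
  obtain ⟨i, hi⟩ := hAB
  simp only [A, B, mem_inter, mem_filter, mem_range] at hi
  have hP := seg (G := G) f i (r - 2) (fun j _ _ => hf1 j) (by
    intro j j' h1 h2 h3 h4 h5
    have h6 : j ≡ j' [MOD N] := hf2 _ _ h5
    rcases Nat.le_total j j' with hjj | hjj
    · have := (Nat.modEq_iff_dvd' hjj).1 h6
      have := Nat.eq_zero_of_dvd_of_lt this (by omega)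
      omega
    · have := (Nat.modEq_iff_dvd' hjj).1 h6.symm
      have := Nat.eq_zero_of_dvd_of_lt this (by omega)
      omega)
  have := hasCycleOfLength_of_pth (u := x) hP (by
    simp only [List.mem_map, not_exists, not_and]
    intro j _ hj
    exact hx (hj ▸ hf4 _)) (hP.ne_of_len (by simp; omega)) hi.1.2 hi.2.2
  have e : r - 2 + 1 + 1 = r := by omega
  simpa [e] using this

end cycles
end DSeq

namespace DSeq
set_option linter.unusedSectionVars false
set_option linter.unusedVariables false
open Finset
section ops
variable {V : Type*} [Fintype V] [DecidableEq V]

theorem keepP {G G' : SimpleGraph V} {a b c e : V} {P : List V}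
    (hC : ∀ s t, G.Adj s t → s(s, t) ≠ s(a, b) → s(s, t) ≠ s(c, e) → G'.Adj s t)
    (h1 : a ∉ P ∨ b ∉ P) (h2 : c ∉ P ∨ e ∉ P) :
    ∀ s ∈ P, ∀ t ∈ P, G.Adj s t → G'.Adj s t := by
  intro s hs t ht hst
  apply hC s t hst
  · simp only [Ne, Sym2.eq_iff]; grind
  · simp only [Ne, Sym2.eq_iff]; grind

theorem tri_cyc {G : SimpleGraph V} {a b c : V} (h1 : G.Adj a b) (h2 : G.Adj b c) (h3 : G.Adj a c) :
    CycAt G {a, b, c} a b c [b, c] where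
  pth := ⟨by simp [h2], by simp [h2.ne], rfl, rfl⟩
  nu := by simp [h1.ne, h3.ne]
  ne := h2.ne
  up := h1
  uq := h3
  eqS := by simp

theorem card_tri {G : SimpleGraph V} {a b c : V} (h1 : G.Adj a b) (h2 : G.Adj b c)
    (h3 : G.Adj a c) : ({a, b, c} : Finset V).card = 3 :=
  card_eq_three.2 ⟨a, b, c, h1.ne, h3.ne, h2.ne, rfl⟩

theorem ext_B {F : SimpleGraph V} {S : Finset V} {m : ℕ} (x0 : V) (hS : HasCyc F S)
    (hc : S.card ≤ 2 * m) (hin : ∀ v ∈ S, v ≠ x0 → m + 1 ≤ dg F v)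
    (hno : ∀ F', SameDeg F F' → ∀ v, v ∉ S → ¬ HasCyc F' (insert v S))
    {v a : V} (hv : v ∉ S) (ha : a ∈ S) (hva : F.Adj v a) (hdv : m + 1 ≤ dg F v) : False := by
  classical
  have hnc : ∀ u p q P, CycAt F S u p q P → F.Adj v u → ¬ F.Adj v p := by
    intro u p q P h hu hp
    exact hno F SameDeg.rfl' v hv (h.ins (fun _ _ _ _ h => h) hv hp hu.symm h.uq).hc
  obtain ⟨p, q, P, h0, hpx⟩ : ∃ p q P, CycAt F S a p q P ∧ p ≠ x0 := by
    obtain ⟨p, q, P, h⟩ := hS.at ha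
    by_cases hp : p = x0
    · exact ⟨q, p, _, h.rev, by rw [← hp]; exact h.ne.symm⟩
    · exact ⟨p, q, P, h, hp⟩
  have hvp := hnc _ _ _ _ h0 hva
  obtain ⟨p2, P', h⟩ := h0.shift
  have hcA := noconsec_card (A := fun s => F.Adj v s) hnc hS
  obtain ⟨b, hb, hvb⟩ : ∃ b, b ∉ S ∧ F.Adj v b := by
    by_contra hh
    push Not at hh
    have : nb F v ⊆ S.filter (fun s => F.Adj v s) := by
      intro s hs
      rw [mem_nb] at hs
      rw [mem_filter]
      refine ⟨?_, hs⟩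
      by_contra hs'
      exact hh s hs' hs
    have := card_le_card this
    unfold dg at hdv
    omega
  have hpS := h.memu
  have hp2S := h.memq
  have haP := h.pth.mem_hd
  have hvP : v ∉ P' := fun hh => hv (h.memP hh)
  have hbP : b ∉ P' := fun hh => hb (h.memP hh)
  have nap2 := h.ne
  have npp2 := h.uq.ne
  have npa := h.up.ne
  have hab : F.Adj a b := by
    by_contra hab
    obtain ⟨F', hF', h1, h2, hC, hD⟩ := two_swap hvb h.up hvp (fun h => hab h.symm)
      (by rintro rfl; exact hv hpS) (by rintro rfl; exact hb ha)
    refine hno F' hF' v hv (h.ins (keepP hC (Or.inl hvP) (Or.inl h.nu)) hv ?_ h1.symm ?_).hc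
    · refine hC _ _ hva ?_ ?_ <;> simp only [Ne, Sym2.eq_iff] <;> grind
    · refine hC _ _ h.uq ?_ ?_ <;> simp only [Ne, Sym2.eq_iff] <;> grind
  have hbp : ¬ F.Adj b p := by
    intro hbp
    exact hno F SameDeg.rfl' b hb (h.ins (fun _ _ _ _ h => h) hb hab.symm hbp.symm h.uq).hc
  have key : ∀ z, F.Adj p z → z ≠ a → z ≠ p2 → z ∈ S ∧ F.Adj v z := by
    intro z hz nza nzp2
    have nzv : z ≠ v := by rintro rfl; exact hvp hz.symm
    have nzb : z ≠ b := by rintro rfl; exact hbp hz.symm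
    have hbz : F.Adj b z := by
      by_contra hbz
      obtain ⟨F', hF', h1, h2, hC, hD⟩ := two_swap hvb hz hvp hbz
        (by rintro rfl; exact hv hpS) nzb.symm
      refine hno F' hF' v hv (h.ins (keepP hC (Or.inl hvP) (Or.inl h.nu)) hv ?_ h1.symm ?_).hc
      · refine hC _ _ hva ?_ ?_ <;> simp only [Ne, Sym2.eq_iff] <;> grind
      · refine hC _ _ h.uq ?_ ?_ <;> simp only [Ne, Sym2.eq_iff] <;> grind
    have hvz : F.Adj v z := by
      by_contra hvz
      obtain ⟨F', hF', h1, h2, hC, hD⟩ := two_swap hvb.symm hz hbp hvz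
        (by rintro rfl; exact hb hpS) nzv.symm
      refine hno F' hF' b hb (h.ins (keepP hC (Or.inl hbP) (Or.inl h.nu)) hb ?_ h1.symm ?_).hc
      · refine hC _ _ hab.symm ?_ ?_ <;> simp only [Ne, Sym2.eq_iff] <;> grind
      · refine hC _ _ h.uq ?_ ?_ <;> simp only [Ne, Sym2.eq_iff] <;> grind
    refine ⟨?_, hvz⟩
    by_contra hzS
    by_cases hza : F.Adj z a
    · exact hno F SameDeg.rfl' z hzS (h.ins (fun _ _ _ _ h => h) hzS hza hz h.uq).hc
    · obtain ⟨F', hF', h1, h2, hC, hD⟩ := two_swap hvz.symm h.up.symm hza hvp nza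
        (by rintro rfl; exact hv hpS)
      refine hno F' hF' z hzS (h.ins (keepP hC (Or.inr hvP) (Or.inr h.nu)) hzS h1 ?_ ?_).hc
      · refine hC _ _ hz ?_ ?_ <;> simp only [Ne, Sym2.eq_iff] <;> grind
      · refine hC _ _ h.uq ?_ ?_ <;> simp only [Ne, Sym2.eq_iff] <;> grind
  have hdp := hin p hpS hpx
  unfold dg at hdp
  by_cases hp2 : F.Adj v p2
  · have : nb F p ⊆ S.filter (fun s => F.Adj v s) := by
      intro z hz
      rw [mem_nb] at hz
      rw [mem_filter]
      by_cases z1 : z = a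
      · subst z1; exact ⟨ha, hva⟩
      by_cases z2 : z = p2
      · subst z2; exact ⟨hp2S, hp2⟩
      exact key z hz z1 z2
    have := card_le_card this
    omega
  · have : (nb F p).erase p2 ⊆ S.filter (fun s => F.Adj v s) := by
      intro z hz
      rw [mem_erase, mem_nb] at hz
      rw [mem_filter]
      by_cases z1 : z = a
      · subst z1; exact ⟨ha, hva⟩
      exact key z hz.2 z1 hz.1
    have h1 := card_le_card this
    have h2 := pred_card_le_card_erase (s := nb F p) (a := p2)
    have h3 := noconsec_card' (A := fun s => F.Adj v s) hnc h.rev hvp hp2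
    omega

theorem extend {F : SimpleGraph V} {S : Finset V} {m : ℕ} (hm : 2 ≤ m) (x0 : V) (hS : HasCyc F S)
    (hc : S.card ≤ 2 * m) (hin : ∀ v ∈ S, v ≠ x0 → m + 1 ≤ dg F v)
    (hout : ∀ v, v ∉ S → 0 < dg F v → m + 1 ≤ dg F v)
    (hex : ∃ v, v ∉ S ∧ 0 < dg F v) :
    ∃ F', SameDeg F F' ∧ ∃ v, v ∉ S ∧ HasCyc F' (insert v S) := by
  by_contra hcon
  have hno : ∀ F', SameDeg F F' → ∀ v, v ∉ S → ¬ HasCyc F' (insert v S) :=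
    fun F' hF' v hv hh => hcon ⟨F', hF', v, hv, hh⟩
  by_cases hA : ∃ v a, v ∉ S ∧ a ∈ S ∧ F.Adj v a
  · obtain ⟨v, a, hv, ha, hva⟩ := hA
    exact ext_B x0 hS hc hin hno hv ha hva (hout v hv (dg_pos.2 ⟨a, hva⟩))
  · push Not at hA
    obtain ⟨v, hv, hdv⟩ := hex
    obtain ⟨w, hw⟩ := dg_pos.1 hdv
    have hwS : w ∉ S := fun h => hA v w hv h hw
    obtain ⟨c, p, q, P, h, hcx⟩ : ∃ c p q P, CycAt F S c p q P ∧ c ≠ x0 := by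
      obtain ⟨u, p, q, P, h⟩ := hS
      by_cases hp : u = x0
      · obtain ⟨p2, P', h'⟩ := h.shift
        exact ⟨p, _, _, _, h', by rw [← hp]; exact h.up.ne'⟩
      · exact ⟨_, p, q, P, h, hp⟩
    have hcS := h.memu
    have hdc := hin c hcS hcx
    obtain ⟨z, hz, hzn⟩ : ∃ z ∈ nb F c, z ∉ ({p, q} : Finset V) := by
      apply exists_mem_notMem_of_card_lt_card
      have : ({p, q} : Finset V).card ≤ 2 := card_le_two
      unfold dg at hdc
      omega
    rw [mem_nb] at hz
    simp only [mem_insert, mem_singleton, not_or] at hzn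
    have hzS : z ∈ S := by
      by_contra hzS
      exact hA z c hzS hcS hz.symm
    have hvP : v ∉ P := fun hh => hv (h.memP hh)
    obtain ⟨F', hF', h1, h2, hC, hD⟩ := two_swap hz hw (fun h => hA v c hv hcS h.symm)
      (fun h => hA w z hwS hzS h.symm) (by rintro rfl; exact hv hcS) (by rintro rfl; exact hwS hzS)
    have h' : CycAt F' S c p q P := by
      refine h.mono (keepP hC (Or.inl h.nu) (Or.inl hvP)) ?_ ?_
      · refine hC _ _ h.up ?_ ?_ <;> simp only [Ne, Sym2.eq_iff] <;> grind
      · refine hC _ _ h.uq ?_ ?_ <;> simp only [Ne, Sym2.eq_iff] <;> grind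
    refine ext_B (F := F') x0 h'.hc hc ?_ ?_ hv hcS h1.symm ?_
    · intro s hs hsx
      rw [← hF' s]; exact hin s hs hsx
    · exact fun F'' hF'' => hno F'' (hF'.tr hF'')
    · rw [← hF' v]; exact hout v hv hdv

theorem triangle {F : SimpleGraph V} (hd : ∀ v, 0 < dg F v → 3 ≤ dg F v) (hex : ∃ v, 0 < dg F v) :
    ∃ F', SameDeg F F' ∧ ∃ S, S.card = 3 ∧ HasCyc F' S := by
  by_contra hcon
  have hno : ∀ F', SameDeg F F' → ∀ a b c, F'.Adj a b → F'.Adj b c → F'.Adj a c → False :=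
    fun F' hF' a b c h1 h2 h3 => hcon ⟨F', hF', _, card_tri h1 h2 h3, (tri_cyc h1 h2 h3).hc⟩
  have pick : ∀ F', SameDeg F F' → ∀ v w s t, F'.Adj v w → ∃ r, F'.Adj v r ∧ r ≠ s ∧ r ≠ t := by
    intro F' hF' v w s t hvw
    have h3 : 3 ≤ dg F' v := by
      rw [← hF' v]; apply hd; rw [hF' v]; exact dg_pos.2 ⟨w, hvw⟩
    obtain ⟨z, hz, hzn⟩ : ∃ z ∈ nb F' v, z ∉ ({s, t} : Finset V) := by
      apply exists_mem_notMem_of_card_lt_card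
      have : ({s, t} : Finset V).card ≤ 2 := card_le_two
      unfold dg at h3
      omega
    simp only [mem_insert, mem_singleton, not_or, mem_nb] at hz hzn
    exact ⟨z, hz, hzn.1, hzn.2⟩
  have sub : ∀ F', SameDeg F F' → ∀ a b v z t, F'.Adj a b → F'.Adj a v → F'.Adj b z → v ≠ b →
      z ≠ a → F'.Adj v t → t ≠ a → t ≠ z → F'.Adj t z := by
    intro F' hF' a b v z t hab hav hbz nvb nza hvt nta ntz
    by_contra htz
    have hvb : ¬ F'.Adj v b := fun h => hno F' hF' a v b hav h hab
    obtain ⟨F1, hF1, h1, h2, hC, hD⟩ := two_swap hvt hbz hvb htz nvb ntz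
    have nab := hab.ne
    have nav := hav.ne
    have nbt : b ≠ t := by rintro rfl; exact hvb hvt
    refine hno F1 (hF'.tr hF1) a v b ?_ h1 ?_
    · refine hC _ _ hav ?_ ?_ <;> simp only [Ne, Sym2.eq_iff] <;> grind
    · refine hC _ _ hab ?_ ?_ <;> simp only [Ne, Sym2.eq_iff] <;> grind
  have nonadj : ∀ F', SameDeg F F' → ∀ a b v z, F'.Adj a b → F'.Adj a v → F'.Adj b z → v ≠ b →
      z ≠ a → ¬ F'.Adj v z := by
    intro F' hF' a b v z hab hav hbz nvb nza hvz
    obtain ⟨t, hvt, nta, ntz⟩ := pick F' hF' v z a z hvz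
    exact hno F' hF' v t z hvt (sub F' hF' a b v z t hab hav hbz nvb nza hvt nta ntz) hvz
  obtain ⟨a, ha⟩ := hex
  obtain ⟨b, hab⟩ := dg_pos.1 ha
  have h0 : SameDeg F F := SameDeg.rfl'
  obtain ⟨v, hav, nvb, -⟩ := pick F h0 a b b b hab
  obtain ⟨z, hbz, nza, -⟩ := pick F h0 b a a a hab.symm
  obtain ⟨z2, hbz2, nz2a, nz2z⟩ := pick F h0 b a a z hab.symm
  obtain ⟨r, hvr, nra, -⟩ := pick F h0 v a a a hav.symm
  have hvz := nonadj F h0 a b v z hab hav hbz nvb nza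
  have hvz2 := nonadj F h0 a b v z2 hab hav hbz2 nvb nz2a
  have nrz : r ≠ z := by rintro rfl; exact hvz hvr
  have nrz2 : r ≠ z2 := by rintro rfl; exact hvz2 hvr
  have hrz := sub F h0 a b v z r hab hav hbz nvb nza hvr nra nrz
  have hrz2 := sub F h0 a b v z2 r hab hav hbz2 nvb nz2a hvr nra nrz2
  have har : ¬ F.Adj a r := fun h => hno F h0 a v r hav hvr h
  have hvb : ¬ F.Adj v b := fun h => hno F h0 a v b hav h hab
  have nvz : v ≠ z := by rintro rfl; exact hvb hbz.symm
  have nrb : r ≠ b := by rintro rfl; exact hvb hvr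
  have nbz := hbz.ne
  have nab := hab.ne
  have nrv := hvr.ne
  obtain ⟨F1, hF1, h1, h2, hC, hD⟩ := two_swap hav hrz har hvz nra.symm nvz
  refine nonadj F1 hF1 a b r z2 ?_ h1 ?_ nrb nz2a ?_
  · refine hC _ _ hab ?_ ?_ <;> simp only [Ne, Sym2.eq_iff] <;> grind
  · refine hC _ _ hbz2 ?_ ?_ <;> simp only [Ne, Sym2.eq_iff] <;> grind
  · refine hC _ _ hrz2 ?_ ?_ <;> simp only [Ne, Sym2.eq_iff] <;> grind

theorem repl_one {F : SimpleGraph V} {S : Finset V} {u p q b y : V} {P : List V}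
    (h : CycAt F S u p q P) (hb : b ∉ S) (hbq : F.Adj b q) (hby : F.Adj b y) (hyu : ¬ F.Adj y u)
    (nyu : y ≠ u) :
    ∃ F', SameDeg F F' ∧ HasCyc F' (insert b (S.erase u)) := by
  by_cases hbp : F.Adj b p
  · exact ⟨F, SameDeg.rfl', (h.repl (fun _ _ _ _ h => h) hb hbp hbq).hc⟩
  have hbP : b ∉ P := fun hh => hb (h.memP hh)
  have nbu : b ≠ u := by rintro rfl; exact hb h.memu
  have nqy : q ≠ y := by rintro rfl; exact hyu h.uq.symm
  have nqb := hbq.ne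
  have nqu := h.uq.ne
  obtain ⟨F', hF', h1, h2, hC, hD⟩ := two_swap hby h.up.symm hbp hyu
    (by rintro rfl; exact hb h.memp) nyu
  refine ⟨F', hF', (h.repl (keepP hC (Or.inl hbP) (Or.inr h.nu)) hb h1 ?_).hc⟩
  refine hC _ _ hbq ?_ ?_ <;> simp only [Ne, Sym2.eq_iff] <;> grind

theorem repl_two {F : SimpleGraph V} {S : Finset V} {u p q b y y2 : V} {P : List V}
    (h : CycAt F S u p q P) (hb : b ∉ S) (hby : F.Adj b y) (hyu : ¬ F.Adj y u)
    (nyu : y ≠ u) (hby2 : F.Adj b y2) (hyu2 : ¬ F.Adj y2 u) (nyu2 : y2 ≠ u) (nyy : y ≠ y2) :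
    ∃ F', SameDeg F F' ∧ HasCyc F' (insert b (S.erase u)) := by
  by_cases hbp : F.Adj b p
  · exact repl_one h.rev hb hbp hby hyu nyu
  have hbP : b ∉ P := fun hh => hb (h.memP hh)
  have nbu : b ≠ u := by rintro rfl; exact hb h.memu
  have nqy : p ≠ y2 := by rintro rfl; exact hyu2 h.up.symm
  have nbp : b ≠ p := by rintro rfl; exact hb h.memp
  have npq := h.ne
  have npu := h.up.ne
  have nqu := h.uq.ne
  obtain ⟨F', hF', h1, h2, hC, hD⟩ := two_swap hby h.up.symm hbp hyu nbp nyu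
  by_cases hbq : F.Adj b q
  · exact repl_one h hb hbq hby hyu nyu
  have nbq : b ≠ q := by rintro rfl; exact hb h.memq
  have nb1 := hby.ne
  have nb2 := hby2.ne
  obtain ⟨F2, hF2, k1, k2, kC, kD⟩ := two_swap (G := F') (a := b) (b := y2) (c := q) (e := u)
    (by refine hC _ _ hby2 ?_ ?_ <;> simp only [Ne, Sym2.eq_iff] <;> grind)
    (by refine hC _ _ h.uq.symm ?_ ?_ <;> simp only [Ne, Sym2.eq_iff] <;> grind)
    (by intro hh; have := hD _ _ hh; simp only [Sym2.eq_iff] at this; grind)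
    (by intro hh; have := hD _ _ hh; simp only [Sym2.eq_iff] at this; grind)
    nbq nyu2
  refine ⟨F2, hF'.tr hF2, (h.repl ?_ hb ?_ k1).hc⟩
  · intro s hs t ht hst
    exact keepP kC (Or.inl hbP) (Or.inr h.nu) s hs t ht
      (keepP hC (Or.inl hbP) (Or.inr h.nu) s hs t ht hst)
  · refine kC _ _ h1 ?_ ?_ <;> simp only [Ne, Sym2.eq_iff] <;> grind

end ops
end DSeq

namespace DSeq
set_option linter.unusedSectionVars false
set_option linter.unusedVariables false
open Finset
section thmB
variable {V : Type*} [Fintype V] [DecidableEq V]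

theorem CycAt.ins2 {G G' : SimpleGraph V} {S : Finset V} {u p q b r : V} {P : List V}
    (h : CycAt G S u p q P) (hG : ∀ s ∈ P, ∀ t ∈ P, G.Adj s t → G'.Adj s t)
    (hb : b ∉ S) (hr : r ∉ S) (hp : G'.Adj b p) (hrb : G'.Adj r b) (hu : G'.Adj u r)
    (hq : G'.Adj u q) :
    CycAt G' (insert r (insert b S)) u r q (r :: b :: P) := by
  have hbP : b ∉ P := fun hbP => hb (h.memP hbP)
  have hrP : r ∉ P := fun hbP => hr (h.memP hbP)
  have nub : u ≠ b := by rintro rfl; exact hb h.memu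
  refine ⟨((h.pth.mono hG).cons hp hbP).cons hrb (by simp [hrP, hrb.ne]), ?_, ?_, hu, hq, ?_⟩
  · simp only [List.mem_cons, not_or]
    exact ⟨hu.ne, nub, h.nu⟩
  · rintro rfl; exact hr h.memq
  · rw [← h.eqS]; ext x; simp; tauto

theorem HasCyc.pos {G : SimpleGraph V} {S : Finset V} (h : HasCyc G S) {v : V} (hv : v ∈ S) :
    0 < dg G v := by
  obtain ⟨p, q, P, h'⟩ := h.at hv
  exact dg_pos.2 ⟨p, h'.up⟩

theorem start_edge {F : SimpleGraph V} {M : Finset V} (hM : 3 ≤ M.card)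
    (hpos : ∀ b ∈ M, 0 < dg F b) (h3 : ∀ v, 0 < dg F v → 3 ≤ dg F v)
    (hdeg : ∀ b ∈ M, ∀ u, u ∉ M → dg F u ≤ dg F b + 1) :
    ∃ F', SameDeg F F' ∧ ∃ b ∈ M, ∃ b' ∈ M, F'.Adj b b' := by
  by_contra hcon
  have hI : ∀ F', SameDeg F F' → ∀ b ∈ M, ∀ b' ∈ M, ¬ F'.Adj b b' :=
    fun F' hF' b hb b' hb' h => hcon ⟨F', hF', b, hb, b', hb', h⟩
  have C1 : ∀ b ∈ M, ∀ b3 ∈ M, b ≠ b3 → ∀ p t, F.Adj b p → F.Adj b3 t → t ≠ p → F.Adj p t := by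
    intro b hb b3 hb3 hne p t hp ht htp
    by_contra hpt
    obtain ⟨F1, hF1, h1, -⟩ := two_swap hp ht (hI F SameDeg.rfl' b hb b3 hb3) hpt hne htp.symm
    exact hI F1 hF1 b hb b3 hb3 h1
  have C2 : ∀ b ∈ M, ∀ b3 ∈ M, ∀ b4 ∈ M, b ≠ b3 → b ≠ b4 → b3 ≠ b4 → ∀ p, F.Adj b p → F.Adj b3 p →
      False := by
    intro b hb b3 hb3 b4 hb4 n1 n2 n3 p hp hp3
    have hpM : p ∉ M := fun h => hI F SameDeg.rfl' b hb p h hp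
    have hd := hdeg b4 hb4 p hpM
    have hnb : b ∉ nb F b4 := by rw [mem_nb]; exact hI F SameDeg.rfl' b4 hb4 b hb
    have hnb3 : b3 ∉ nb F b4 := by rw [mem_nb]; exact hI F SameDeg.rfl' b4 hb4 b3 hb3
    by_cases hp4 : F.Adj b4 p
    · have hsub : insert b4 (insert b (insert b3 ((nb F b4).erase p))) ⊆ nb F p := by
        intro t ht
        simp only [mem_insert, mem_erase, mem_nb] at ht ⊢
        rcases ht with rfl | rfl | rfl | ht
        · exact hp4.symm
        · exact hp.symm
        · exact hp3.symm
        · exact C1 b hb b4 hb4 n2 p t hp ht.2 ht.1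
      have hc := card_le_card hsub
      rw [card_insert_of_notMem, card_insert_of_notMem, card_insert_of_notMem,
        card_erase_of_mem (mem_nb.2 hp4)] at hc
      · unfold dg at hd; omega
      · simp [hnb3]
      · simp [hnb, n1]
      · simp [n2.symm, n3.symm, mem_nb]
    · have hsub : insert b (insert b3 (nb F b4)) ⊆ nb F p := by
        intro t ht
        simp only [mem_insert, mem_nb] at ht ⊢
        rcases ht with rfl | rfl | ht
        · exact hp.symm
        · exact hp3.symm
        · exact C1 b hb b4 hb4 n2 p t hp ht (by rintro rfl; exact hp4 ht)
      have hc := card_le_card hsub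
      rw [card_insert_of_notMem, card_insert_of_notMem hnb3] at hc
      · unfold dg at hd; omega
      · simp [hnb, n1]
  obtain ⟨b, b3, b4, hb, hb3, hb4, n1, n2, n3⟩ := two_lt_card_iff.1 (show 2 < M.card by omega)
  obtain ⟨p, hp⟩ := dg_pos.1 (hpos b hb)
  have hpM : p ∉ M := fun h => hI F SameDeg.rfl' b hb p h hp
  have hsub : nb F b3 ∪ nb F b4 ⊆ nb F p := by
    intro t ht
    simp only [mem_union, mem_nb] at ht ⊢
    rcases ht with ht | ht
    · exact C1 b hb b3 hb3 n1 p t hp ht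
        (by rintro rfl; exact C2 b hb b3 hb3 b4 hb4 n1 n2 n3 t hp ht)
    · exact C1 b hb b4 hb4 n2 p t hp ht
        (by rintro rfl; exact C2 b hb b4 hb4 b3 hb3 n2 n1 n3.symm t hp ht)
  have hc := card_le_card hsub
  rw [card_union_of_disjoint] at hc
  · have := hdeg b3 hb3 p hpM
    have := h3 b4 (hpos b4 hb4)
    unfold dg at *
    omega
  · rw [disjoint_left]
    intro t ht ht'
    rw [mem_nb] at ht ht'
    exact C2 b3 hb3 b4 hb4 b hb n3 n1.symm n2.symm t ht ht'

theorem start_tri {F : SimpleGraph V} {M : Finset V} (hM : 3 ≤ M.card)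
    (hpos : ∀ b ∈ M, 0 < dg F b) (h3 : ∀ v, 0 < dg F v → 3 ≤ dg F v)
    (hdeg : ∀ b ∈ M, ∀ u, u ∉ M → dg F u ≤ dg F b + 1) {b b' : V} (hb : b ∈ M) (hb' : b' ∈ M)
    (hbb : F.Adj b b') :
    ∃ F', SameDeg F F' ∧ ∃ a ∈ M, ∃ c ∈ M, ∃ e, F'.Adj a c ∧ F'.Adj c e ∧ F'.Adj a e := by
  by_contra hcon
  have hno : ∀ F', SameDeg F F' → ∀ a ∈ M, ∀ c ∈ M, ∀ e, F'.Adj a c → F'.Adj c e → F'.Adj a e →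
      False := fun F' hF' a ha c hc e h1 h2 h3 => hcon ⟨F', hF', a, ha, c, hc, e, h1, h2, h3⟩
  have h0 : SameDeg F F := SameDeg.rfl'
  have pick : ∀ v w s t, F.Adj v w → ∃ r, F.Adj v r ∧ r ≠ s ∧ r ≠ t := by
    intro v w s t hvw
    have h3 : 3 ≤ dg F v := h3 v (dg_pos.2 ⟨w, hvw⟩)
    obtain ⟨z, hz, hzn⟩ : ∃ z ∈ nb F v, z ∉ ({s, t} : Finset V) := by
      apply exists_mem_notMem_of_card_lt_card
      have : ({s, t} : Finset V).card ≤ 2 := card_le_two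
      unfold dg at h3
      omega
    simp only [mem_insert, mem_singleton, not_or, mem_nb] at hz hzn
    exact ⟨z, hz, hzn.1, hzn.2⟩
  have sub : ∀ b ∈ M, ∀ b' ∈ M, F.Adj b b' → ∀ v z t, F.Adj b v → v ≠ b' → F.Adj b' z → z ≠ b →
      F.Adj v t → t ≠ b → t ≠ z → F.Adj t z := by
    intro b hb b' hb' hbb v z t hv nv hz nz ht nt ntz
    by_contra htz
    have hvb : ¬ F.Adj v b' := fun h => hno F h0 b hb b' hb' v hbb h.symm hv
    have := hbb.ne
    have := hv.ne
    have : t ≠ b' := by rintro rfl; exact hvb ht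
    obtain ⟨F1, hF1, h1, h2, hC, hD⟩ := two_swap ht hz hvb htz nv ntz
    refine hno F1 hF1 b hb b' hb' v ?_ h1.symm ?_
    · refine hC _ _ hbb ?_ ?_ <;> simp only [Ne, Sym2.eq_iff] <;> grind
    · refine hC _ _ hv ?_ ?_ <;> simp only [Ne, Sym2.eq_iff] <;> grind
  have nocom : ∀ b ∈ M, ∀ b' ∈ M, F.Adj b b' → ∀ v, F.Adj b v → ¬ F.Adj b' v :=
    fun b hb b' hb' hbb v hv hv' => hno F h0 b hb b' hb' v hbb hv' hv
  by_cases hvz : ∃ v z, F.Adj b v ∧ v ≠ b' ∧ F.Adj b' z ∧ z ≠ b ∧ F.Adj v z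
  · -- the clique case
    have clique : ∀ b ∈ M, ∀ b' ∈ M, F.Adj b b' →
        (∃ v z, F.Adj b v ∧ v ≠ b' ∧ F.Adj b' z ∧ z ≠ b ∧ F.Adj v z) →
        ∀ v', F.Adj b v' → v' ≠ b' → (∀ z', F.Adj b' z' → z' ≠ b → F.Adj v' z') ∧
          (∀ v2, F.Adj b v2 → v2 ≠ b' → v2 ≠ v' → F.Adj v' v2) := by
      intro b hb b' hb' hbb ⟨v, z, hv, nv, hz, nz, hvz⟩
      have nzb : ∀ z, F.Adj b' z → ¬ F.Adj b z := fun z h h' => nocom b hb b' hb' hbb z h' h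
      -- if v ~ z then v is adjacent to everything
      have step : ∀ v z, F.Adj b v → v ≠ b' → F.Adj b' z → z ≠ b → F.Adj v z →
          (∀ z', F.Adj b' z' → z' ≠ b → F.Adj v z') ∧
          (∀ v2, F.Adj b v2 → v2 ≠ b' → v2 ≠ v → F.Adj v v2) := by
        intro v z hv nv hz nz hvz
        constructor
        · intro z' hz' nz'
          by_cases e : z' = z
          · subst e; exact hvz
          · have h1 := sub b hb b' hb' hbb v z' z hv nv hz' nz' hvz nz (Ne.symm e)
            have nvz' : z' ≠ v := by rintro rfl; exact nzb _ hz' hv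
            exact (sub b' hb' b hb hbb.symm z v z' hz nz hv nv h1 hz'.ne' nvz').symm
        · intro v2 hv2 nv2 e
          exact sub b' hb' b hb hbb.symm z v2 v hz nz hv2 nv2 hvz.symm nv e.symm
      intro v' hv' nv'
      by_cases e : v' = v
      · subst e; exact step v' z hv' nv' hz nz hvz
      · have h1 := (step v z hv nv hz nz hvz).2 v' hv' nv' e
        have nzv : v' ≠ z := by rintro rfl; exact nzb _ hz hv'
        have h2 : F.Adj v' z := by
          have := sub b hb b' hb' hbb v z v' hv nv hz nz h1 hv'.ne' nzv
          exact this
        exact step v' z hv' nv' hz nz h2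
    have side : ∀ b ∈ M, ∀ b' ∈ M, F.Adj b b' →
        (∃ v z, F.Adj b v ∧ v ≠ b' ∧ F.Adj b' z ∧ z ≠ b ∧ F.Adj v z) →
        ∀ v', F.Adj b v' → v' ≠ b' → ∀ t, F.Adj v' t → t = b ∨ F.Adj b t ∨ F.Adj b' t := by
      intro b hb b' hb' hbb hex v hv nv t ht
      by_contra hh
      push Not at hh
      obtain ⟨hh1, hh2, hh3⟩ := hh
      obtain ⟨c1, c2⟩ := clique b hb b' hb' hbb hex v hv nv
      obtain ⟨v2, hv2, nv2, nvv⟩ := pick b b' b' v hbb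
      have hvM : v ∉ M := fun hvM => hno F h0 b hb v hvM v2 hv (c2 v2 hv2 nv2 nvv) hv2
      have hd := hdeg b' hb' v hvM
      have hsub : insert t (insert v2 (nb F b')) ⊆ nb F v := by
        intro s hs
        simp only [mem_insert, mem_nb] at hs ⊢
        rcases hs with rfl | rfl | hs
        · exact ht
        · exact c2 _ hv2 nv2 nvv
        · by_cases e : s = b
          · subst e; exact hv.symm
          · exact c1 s hs e
      have hc := card_le_card hsub
      rw [card_insert_of_notMem, card_insert_of_notMem] at hc
      · unfold dg at hd; omega
      · rw [mem_nb]; exact nocom b hb b' hb' hbb v2 hv2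
      · simp only [mem_insert, mem_nb, not_or]
        exact ⟨by rintro rfl; exact hh2 hv2, hh3⟩
    have hex' : ∃ v z, F.Adj b' v ∧ v ≠ b ∧ F.Adj b z ∧ z ≠ b' ∧ F.Adj v z := by
      obtain ⟨v, z, h1, h2, h3, h4, h5⟩ := hvz
      exact ⟨z, v, h3, h4, h1, h2, h5.symm⟩
    obtain ⟨v, hv, nv, -⟩ := pick b b' b' b' hbb
    obtain ⟨v2, hv2, nv2, nvv⟩ := pick b b' b' v hbb
    obtain ⟨z, hz, nz, -⟩ := pick b' b b b hbb.symm
    obtain ⟨z2, hz2, nz2, nzz⟩ := pick b' b b z hbb.symm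
    obtain ⟨b3, hb3, nb3⟩ : ∃ b3 ∈ M, b3 ∉ ({b, b'} : Finset V) := by
      apply exists_mem_notMem_of_card_lt_card
      have : ({b, b'} : Finset V).card ≤ 2 := card_le_two
      omega
    simp only [mem_insert, mem_singleton, not_or] at nb3
    have hvv := (clique b hb b' hb' hbb hvz v hv nv).2 v2 hv2 nv2 nvv
    have hzz := (clique b' hb' b hb hbb.symm hex' z hz nz).2 z2 hz2 nz2 nzz
    have a1 : ¬ F.Adj b b3 := by
      intro h
      obtain ⟨w, hw, nw, nw3⟩ := pick b b' b' b3 hbb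
      exact hno F h0 b hb b3 hb3 w h
        ((clique b hb b' hb' hbb hvz b3 h nb3.2).2 w hw nw nw3) hw
    have a2 : ¬ F.Adj b' b3 := by
      intro h
      obtain ⟨w, hw, nw, nw3⟩ := pick b' b b b3 hbb.symm
      exact hno F h0 b' hb' b3 hb3 w h
        ((clique b' hb' b hb hbb.symm hex' b3 h nb3.1).2 w hw nw nw3) hw
    -- neighbours of b3 are not neighbours of v
    have a3 : ∀ y, F.Adj b3 y → ¬ F.Adj y v ∧ y ≠ v := by
      intro y hy
      have nob : ∀ w, F.Adj b w → w ≠ b' → ¬ F.Adj w b3 := by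
        intro w hw nw h
        rcases side b hb b' hb' hbb hvz w hw nw b3 h with h | h | h
        · exact nb3.1 h
        · exact a1 h
        · exact a2 h
      have nob' : ∀ w, F.Adj b' w → w ≠ b → ¬ F.Adj w b3 := by
        intro w hw nw h
        rcases side b' hb' b hb hbb.symm hex' w hw nw b3 h with h | h | h
        · exact nb3.2 h
        · exact a2 h
        · exact a1 h
      constructor
      · intro hyv
        rcases side b hb b' hb' hbb hvz v hv nv y hyv.symm with h | h | h
        · subst h; exact a1 hy.symm
        · by_cases e : y = b'
          · subst e; exact a2 hy.symm
          · exact nob y h e hy.symm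
        · by_cases e : y = b
          · subst e; exact a1 hy.symm
          · exact nob' y h e hy.symm
      · rintro rfl
        exact nob y hv nv hy.symm
    obtain ⟨w0, hw0⟩ := dg_pos.1 (hpos b3 hb3)
    obtain ⟨y, hy, -, -⟩ := pick b3 w0 w0 w0 hw0
    obtain ⟨y2, hy2, nyy, -⟩ := pick b3 w0 y y hw0
    have hcyc := tri_cyc hv.symm hv2 hvv
    have hb3S : b3 ∉ ({v, b, v2} : Finset V) := by
      simp only [mem_insert, mem_singleton, not_or]
      refine ⟨?_, nb3.1, ?_⟩
      · rintro rfl; exact a1 hv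
      · rintro rfl; exact a1 hv2
    obtain ⟨F', hF', hc'⟩ := repl_two hcyc hb3S hy (a3 y hy).1 (a3 y hy).2 hy2 (a3 y2 hy2).1
      (a3 y2 hy2).2 nyy.symm
    have hset : insert b3 (({v, b, v2} : Finset V).erase v) = {b3, b, v2} := by
      have := hv.ne'
      have := hvv.ne
      ext t
      simp only [mem_insert, mem_erase, mem_singleton]
      grind
    rw [hset] at hc'
    obtain ⟨p, q, P, hc''⟩ := hc'.at (w := b3) (by simp)
    have hl := hc''.card
    rw [card_eq_three.2 ⟨b3, b, v2, nb3.1, by rintro rfl; exact a1 hv2, hv2.ne, rfl⟩] at hl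
    obtain ⟨p2, P2, hsh⟩ := hc''.shift
    have hpq : F'.Adj p q := by
      have hch := hc''.pth.ch
      have hhd := hc''.pth.hd
      have hlt := hc''.pth.lt
      rcases P with _ | ⟨s, _ | ⟨t, _ | ⟨t', P⟩⟩⟩
      · simp at hl
      · simp at hl
      · simp at hch hhd hlt; subst hhd; subst hlt; exact hch
      · simp at hl
    have hbp : b = p ∨ b = q := by
      have hp := hc''.memp
      have hq := hc''.memq
      have := hc''.up.ne
      have := hc''.uq.ne
      have := hc''.ne
      simp only [mem_insert, mem_singleton] at hp hq
      grind
    rcases hbp with rfl | rfl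
    · exact hno F' hF' b3 hb3 b hb q hc''.up hpq hc''.uq
    · exact hno F' hF' b3 hb3 b hb p hc''.uq hpq.symm hc''.up
  · push Not at hvz
    obtain ⟨v, hv, nv, -⟩ := pick b b' b' b' hbb
    obtain ⟨z, hz, nz, -⟩ := pick b' b b b hbb.symm
    obtain ⟨z2, hz2, nz2, nzz⟩ := pick b' b b z hbb.symm
    obtain ⟨r, hr, nr, -⟩ := pick v b b b hv.symm
    have k1 := hvz v z hv nv hz nz
    have k2 := hvz v z2 hv nv hz2 nz2
    have nrz : r ≠ z := by rintro rfl; exact k1 hr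
    have hrz := sub b hb b' hb' hbb v z r hv nv hz nz hr nr nrz
    have nrb' : r ≠ b' := by rintro rfl; exact nocom b hb r hb' hbb v hv hr.symm
    have hbr : ¬ F.Adj b r := fun h => hvz r z h nrb' hz nz hrz
    have hb'r : ¬ F.Adj b' r := fun h => hvz v r hv nv h nr hr
    have nvz : v ≠ z := by rintro rfl; exact nocom b hb b' hb' hbb v hv hz
    have nvz2 : v ≠ z2 := by rintro rfl; exact nocom b hb b' hb' hbb v hv hz2
    have e1 := hbb.ne
    have e2 := hv.ne
    have e3 := hz.ne
    have e4 := hz2.ne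
    have e5 := hr.ne
    obtain ⟨F1, hF1, h1, h2, hC, hD⟩ := two_swap hv hrz hbr k1 nr.symm nvz
    obtain ⟨F2, hF2, g1, g2, gC, gD⟩ := two_swap (G := F1) (a := b') (b := z2) (c := r) (e := v)
      (by refine hC _ _ hz2 ?_ ?_ <;> simp only [Ne, Sym2.eq_iff] <;> grind)
      (by refine hC _ _ hr.symm ?_ ?_ <;> simp only [Ne, Sym2.eq_iff] <;> grind)
      (by intro hh; have := hD _ _ hh; simp only [Sym2.eq_iff] at this; grind)
      (by intro hh; have := hD _ _ hh; simp only [Sym2.eq_iff] at this; have := F.adj_comm; grind)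
      nrb'.symm nvz2.symm
    refine hno F2 (hF1.tr hF2) b hb b' hb' r ?_ g1 ?_
    · refine gC _ _ (hC _ _ hbb ?_ ?_) ?_ ?_ <;> simp only [Ne, Sym2.eq_iff] <;> grind
    · refine gC _ _ h1 ?_ ?_ <;> simp only [Ne, Sym2.eq_iff] <;> grind

end thmB
end DSeq

namespace DSeq
set_option linter.unusedSectionVars false
set_option linter.unusedVariables false
open Finset
section gain
variable {V : Type*} [Fintype V] [DecidableEq V]

theorem gain_sub {F : SimpleGraph V} {S R : Finset V} {b : V} (hS : HasCyc F S)
    (hb : b ∉ S) (hR : R ⊆ S) (hRb : ∀ r ∈ R, F.Adj b r) (hc : S.card < 2 * R.card) :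
    HasCyc F (insert b S) := by
  classical
  have : R ⊆ S.filter (fun s => F.Adj b s) := fun r hr => mem_filter.2 ⟨hR hr, hRb r hr⟩
  have h1 := card_le_card this
  obtain ⟨u, p, q, P, h, hu, hp⟩ := pigeon (A := fun s => F.Adj b s) hS (by omega)
  exact (h.ins (fun _ _ _ _ h => h) hb hp hu.symm h.uq).hc

theorem gain_i {F : SimpleGraph V} {S : Finset V} {u p q b : V} {P : List V} {m : ℕ}
    (h : CycAt F S u p q P) (hb : b ∉ S) (hc : S.card ≤ 2 * m) (hdb : m + 1 ≤ dg F b)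
    (hR : ∀ F', SameDeg F F' → ¬ HasCyc F' (insert b (S.erase u)))
    (hI : ∀ F', SameDeg F F' → ¬ HasCyc F' (insert b S))
    (hI2 : ∀ F' r, SameDeg F F' → r ∉ S → ¬ HasCyc F' (insert r (insert b S)))
    (hbq : F.Adj b q) : False := by
  have h0 : SameDeg F F := SameDeg.rfl'
  have hsub : ∀ y, F.Adj b y → y ≠ u → F.Adj y u := by
    intro y hy nyu
    by_contra hyu
    obtain ⟨F', hF', h'⟩ := repl_one h hb hbq hy hyu nyu
    exact hR F' hF' h'
  by_cases hbu : F.Adj b u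
  · exact hI F h0 (h.rev.ins (fun _ _ _ _ h => h) hb hbq hbu.symm h.up).hc
  by_cases hex : ∃ r, F.Adj b r ∧ r ∉ S
  · obtain ⟨r, hbr, hr⟩ := hex
    have nru : r ≠ u := by rintro rfl; exact hbu hbr
    exact hI2 F r h0 hr (h.rev.ins2 (fun _ _ _ _ h => h) hb hr hbq hbr.symm
      (hsub r hbr nru).symm h.up).hc
  · push Not at hex
    refine hI F h0 (gain_sub (R := nb F b) h.hc hb (fun r hr => hex r (mem_nb.1 hr))
      (fun r hr => mem_nb.1 hr) ?_)
    unfold dg at hdb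
    omega

theorem gain_u {F : SimpleGraph V} {S : Finset V} {u b : V} {m : ℕ}
    (hS : HasCyc F S) (hu : u ∈ S) (hb : b ∉ S) (hc : S.card + 1 ≤ 2 * m) (hdb : m + 1 ≤ dg F b)
    (hdu : dg F u ≤ dg F b + 1)
    (hR : ∀ F', SameDeg F F' → ¬ HasCyc F' (insert b (S.erase u)))
    (hI : ∀ F', SameDeg F F' → ¬ HasCyc F' (insert b S))
    (hI2 : ∀ F' r, SameDeg F F' → r ∉ S → ¬ HasCyc F' (insert r (insert b S))) : False := by
  obtain ⟨p, q, P, h⟩ := hS.at hu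
  have h0 : SameDeg F F := SameDeg.rfl'
  by_cases hbq : F.Adj b q
  · exact gain_i h hb (by omega) hdb hR hI hI2 hbq
  by_cases hbp : F.Adj b p
  · exact gain_i h.rev hb (by omega) hdb hR hI hI2 hbp
  have nbu : b ≠ u := by rintro rfl; exact hb hu
  have nbp : b ≠ p := by rintro rfl; exact hb h.memp
  have nbq : b ≠ q := by rintro rfl; exact hb h.memq
  have npq := h.ne
  have nup := h.up.ne
  have nuq := h.uq.ne
  have hbP : b ∉ P := fun hh => hb (h.memP hh)
  obtain ⟨y, hby, nyu, hyu⟩ : ∃ y, F.Adj b y ∧ y ≠ u ∧ ¬ F.Adj y u := by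
    by_contra hh
    push Not at hh
    have hs : ((nb F b).erase u) ∪ {p, q} ⊆ nb F u := by
      intro z hz
      simp only [mem_union, mem_erase, mem_insert, mem_singleton, mem_nb] at hz ⊢
      rcases hz with hz | rfl | rfl
      · exact (hh z hz.2 hz.1).symm
      · exact h.up
      · exact h.uq
    have hdis : Disjoint ((nb F b).erase u) {p, q} := by
      rw [disjoint_left]
      intro z hz
      simp only [mem_erase, mem_insert, mem_singleton, mem_nb] at hz ⊢
      grind
    have hc2 : ({p, q} : Finset V).card = 2 := card_pair npq
    unfold dg at hdu
    by_cases hbu : F.Adj b u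
    · have hs' : insert b (((nb F b).erase u) ∪ {p, q}) ⊆ nb F u := by
        apply insert_subset _ hs
        rw [mem_nb]; exact hbu.symm
      have h1 := card_le_card hs'
      rw [card_insert_of_notMem, card_union_of_disjoint hdis, card_erase_of_mem (mem_nb.2 hbu),
        hc2] at h1
      · omega
      · simp [mem_nb, nbp, nbq]
    · have h1 := card_le_card hs
      rw [card_union_of_disjoint hdis, erase_eq_of_notMem (by rwa [mem_nb]), hc2] at h1
      omega
  have huniq : ∀ r, F.Adj b r → r ≠ u → r ≠ y → F.Adj r u := by
    intro r hr nru nry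
    by_contra hru
    obtain ⟨F', hF', h'⟩ := repl_two h hb hby hyu nyu hr hru nru nry.symm
    exact hR F' hF' h'
  have nyq : y ≠ q := by rintro rfl; exact hbq hby
  have nyp : y ≠ p := by rintro rfl; exact hbp hby
  have nby := hby.ne
  obtain ⟨F', hF', h1, h2, hC, hD⟩ := two_swap hby h.up.symm hbp hyu nbp nyu
  have hk := keepP (P := P) hC (Or.inl hbP) (Or.inr h.nu)
  have huq : F'.Adj u q := by
    refine hC _ _ h.uq ?_ ?_ <;> simp only [Ne, Sym2.eq_iff] <;> grind
  by_cases hbu : F.Adj b u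
  · refine hI F' hF' (h.ins hk hb h1 ?_ huq).hc
    refine hC _ _ hbu.symm ?_ ?_ <;> simp only [Ne, Sym2.eq_iff] <;> grind
  by_cases hex : ∃ r, F.Adj b r ∧ r ≠ y ∧ r ∉ S
  · obtain ⟨r, hbr, nry, hr⟩ := hex
    have nru : r ≠ u := by rintro rfl; exact hbu hbr
    have nrp : r ≠ p := by rintro rfl; exact hr h.memp
    have nrb := hbr.ne
    have hru := huniq r hbr nru nry
    refine hI2 F' r hF' hr (h.ins2 hk hb hr h1 ?_ ?_ huq).hc
    · refine hC _ _ hbr.symm ?_ ?_ <;> simp only [Ne, Sym2.eq_iff] <;> grind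
    · refine hC _ _ hru.symm ?_ ?_ <;> simp only [Ne, Sym2.eq_iff] <;> grind
  · push Not at hex
    refine hI F h0 (gain_sub (R := (nb F b).erase y) h.hc hb ?_ ?_ ?_)
    · intro r hr
      rw [mem_erase, mem_nb] at hr
      exact hex r hr.2 hr.1
    · intro r hr
      rw [mem_erase, mem_nb] at hr
      exact hr.2
    · rw [card_erase_of_mem (mem_nb.2 hby)]
      unfold dg at hdb
      omega

/-- Increase the number of vertices of `M` on the cycle. -/
theorem gain {F : SimpleGraph V} {S M : Finset V} {m : ℕ} (hm : 2 ≤ m)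
    (hS : HasCyc F S) (hk : (S ∩ M).card ≤ m) (hc : S.card < 2 * (S ∩ M).card)
    (hM : m + 1 ≤ M.card) (hpos : ∀ v, 0 < dg F v → m + 1 ≤ dg F v)
    (hMp : ∀ b ∈ M, 0 < dg F b) (hdeg : ∀ b ∈ M, ∀ u, u ∉ M → dg F u ≤ dg F b + 1) :
    ∃ F', SameDeg F F' ∧ ∃ S', HasCyc F' S' ∧ S'.card < 2 * (S' ∩ M).card ∧
      (S ∩ M).card < (S' ∩ M).card ∧ S'.card ≤ 2 * m + 1 := by
  by_contra hcon
  have hno : ∀ F', SameDeg F F' → ∀ S', HasCyc F' S' → S'.card ≤ S.card + 2 →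
      (S ∩ M).card < (S' ∩ M).card → False := by
    intro F' hF' S' h1 h2 h3
    exact hcon ⟨F', hF', S', h1, by omega, h3, by omega⟩
  have h3 := hS.card3
  -- the main step, from a cycle with a vertex outside `M`
  have main : ∀ F1 S1, SameDeg F F1 → HasCyc F1 S1 → (S1 ∩ M).card = (S ∩ M).card →
      S1.card < 2 * (S ∩ M).card → (S1.card = S.card ∨ (S1.card = S.card + 1 ∧ 3 ≤ (S ∩ M).card ∧
        S.card = (S ∩ M).card)) → (∃ u ∈ S1, u ∉ M) → False := by
    rintro F1 S1 hF1 hS1 hk1 hc1 hcc ⟨u, hu, huM⟩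
    obtain ⟨b, hbM, hbS⟩ : ∃ b ∈ M, b ∉ S1 ∩ M := by
      apply exists_mem_notMem_of_card_lt_card
      omega
    have hb : b ∉ S1 := fun h => hbS (mem_inter.2 ⟨h, hbM⟩)
    have hIM : (insert b S1 ∩ M).card = (S ∩ M).card + 1 := by
      rw [insert_inter_of_mem hbM, card_insert_of_notMem hbS, hk1]
    have hno1 : ∀ F', SameDeg F1 F' → ∀ S', HasCyc F' S' → S'.card ≤ S1.card + 2 →
        (S ∩ M).card < (S' ∩ M).card → False := by
      intro F' hF' S' h1 h2 h3
      exact hcon ⟨F', hF1.tr hF', S', h1, by omega, h3, by omega⟩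
    refine gain_u (F := F1) (m := m) hS1 hu hb (by omega) ?_ ?_ ?_ ?_ ?_
    · rw [← hF1 b]; exact hpos b (hMp b hbM)
    · rw [← hF1 b, ← hF1 u]; exact hdeg b hbM u huM
    · intro F' hF' h
      refine hno1 F' hF' _ h ?_ ?_
      · rw [card_insert_of_notMem (fun h => hb (mem_of_mem_erase h)), card_erase_of_mem hu]
        omega
      · have : (insert b (S1.erase u) ∩ M) = insert b S1 ∩ M := by
          ext z; simp only [mem_inter, mem_insert, mem_erase]; grind
        rw [this, hIM]; omega
    · intro F' hF' h
      refine hno1 F' hF' _ h ?_ (by rw [hIM]; omega)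
      rw [card_insert_of_notMem hb]; omega
    · intro F' r hF' hr h
      refine hno1 F' hF' _ h ?_ ?_
      · have e1 := card_insert_le r (insert b S1)
        have e2 := card_insert_le b S1
        omega
      · have : (insert b S1 ∩ M) ⊆ insert r (insert b S1) ∩ M := by
          apply inter_subset_inter_right
          exact subset_insert _ _
        have := card_le_card this
        omega
  by_cases hSM : ∃ u ∈ S, u ∉ M
  · exact main F S SameDeg.rfl' hS rfl hc (Or.inl rfl) hSM
  · push Not at hSM
    have hSM' : S ∩ M = S := inter_eq_left.2 hSM
    rw [hSM'] at hk hc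
    obtain ⟨b, hbM, hbS⟩ : ∃ b ∈ M, b ∉ S := by
      apply exists_mem_notMem_of_card_lt_card
      omega
    obtain ⟨u0, hu0⟩ : S.Nonempty := card_pos.1 (by omega)
    obtain ⟨F1, hF1, v, hv, hc1⟩ := extend hm u0 hS (by omega)
      (fun s hs _ => hpos s (hMp s (hSM s hs))) (fun s _ hs => hpos s hs) ⟨b, hbS, hMp b hbM⟩
    by_cases hvM : v ∈ M
    · refine hno F1 hF1 _ hc1 (by rw [card_insert_of_notMem hv]; omega) ?_
      rw [insert_inter_of_mem hvM, hSM', card_insert_of_notMem hv]; omega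
    · refine main F1 (insert v S) hF1 hc1 ?_ ?_ ?_ ⟨v, mem_insert_self _ _, hvM⟩
      · rw [insert_inter_of_notMem hvM]
      · rw [card_insert_of_notMem hv, hSM']; omega
      · rw [card_insert_of_notMem hv, hSM']; right; exact ⟨rfl, h3, rfl⟩

theorem gain_iter {M : Finset V} {m : ℕ} (hm : 2 ≤ m) (hM : m + 1 ≤ M.card) (j : ℕ) :
    ∀ (F : SimpleGraph V) (S : Finset V), 
    HasCyc F S → m + 1 ≤ (S ∩ M).card + j → S.card < 2 * (S ∩ M).card → S.card ≤ 2 * m + 1 →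
    (∀ v, 0 < dg F v → m + 1 ≤ dg F v) →
    (∀ b ∈ M, 0 < dg F b) → (∀ b ∈ M, ∀ u, u ∉ M → dg F u ≤ dg F b + 1) →
    ∃ F', SameDeg F F' ∧ ∃ S', HasCyc F' S' ∧ m + 1 ≤ (S' ∩ M).card ∧ S'.card ≤ 2 * m + 1 := by
  induction j with
  | zero =>
    intro F S hS hk hc hc2 _ _ _
    exact ⟨F, SameDeg.rfl', S, hS, hk, hc2⟩
  | succ j ih =>
    intro F S hS hk hc hc2 hpos hMp hdeg
    by_cases hk2 : m + 1 ≤ (S ∩ M).card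
    · exact ⟨F, SameDeg.rfl', S, hS, hk2, hc2⟩
    obtain ⟨F1, hF1, S1, h1, h2, h3, h4⟩ := gain hm hS (by omega) hc hM hpos hMp hdeg
    obtain ⟨F2, hF2, h⟩ := ih F1 S1 h1 (by omega) h2 h4 (fun v => by rw [← hF1 v]; exact hpos v)
      (fun b hb => by rw [← hF1 b]; exact hMp b hb)
      (fun b hb u hu => by rw [← hF1 b, ← hF1 u]; exact hdeg b hb u hu)
    exact ⟨F2, hF1.tr hF2, h⟩

theorem grow {m N0 : ℕ} (hm : 2 ≤ m) (x0 : V) (hN0 : N0 ≤ 2 * m + 1) (j : ℕ) :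
    ∀ (F : SimpleGraph V) (S : Finset V), HasCyc F S → S.card + j = N0 →
    N0 ≤ (univ.filter (fun v => 0 < dg F v)).card →
    (∀ v, 0 < dg F v → m + 1 ≤ dg F v ∨ (v = x0 ∧ x0 ∈ S)) →
    ∃ F', SameDeg F F' ∧ ∃ S', S ⊆ S' ∧ HasCyc F' S' ∧ S'.card = N0 := by
  induction j with
  | zero =>
    intro F S hS hj _ _
    exact ⟨F, SameDeg.rfl', S, Subset.rfl, hS, hj⟩
  | succ j ih =>
    intro F S hS hj hN hpos
    obtain ⟨v, hv, hvS⟩ : ∃ v ∈ (univ.filter (fun v => 0 < dg F v)), v ∉ S := by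
      apply exists_mem_notMem_of_card_lt_card
      omega
    obtain ⟨F1, hF1, w, hw, h1⟩ := extend (m := m) hm x0 hS (by omega)
      (fun s hs hsx => by
        rcases hpos s (hS.pos hs) with h | h
        · exact h
        · exact absurd h.1 hsx)
      (fun s hs hs0 => by
        rcases hpos s hs0 with h | h
        · exact h
        · exact absurd (h.1 ▸ h.2) hs)
      ⟨v, hvS, (mem_filter.1 hv).2⟩
    obtain ⟨F2, hF2, S2, h2, h3, h4⟩ := ih F1 (insert w S) h1
      (by rw [card_insert_of_notMem hw]; omega)
      (by
        have : (fun v => 0 < dg F1 v) = (fun v => 0 < dg F v) := by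
          funext v; rw [hF1 v]
        simp only [this]; exact hN)
      (fun v => by
        rw [← hF1 v]
        intro h
        rcases hpos v h with h | h
        · exact Or.inl h
        · exact Or.inr ⟨h.1, mem_insert_of_mem h.2⟩)
    exact ⟨F2, hF1.tr hF2, S2, fun z hz => h2 (mem_insert_of_mem hz), h3, h4⟩

/-- Theorem B. -/
theorem theoremB {F : SimpleGraph V} {M : Finset V} {m : ℕ} (hm : 2 ≤ m) (hM : m + 1 ≤ M.card)
    (hpos : ∀ v, 0 < dg F v → m + 1 ≤ dg F v)
    (hMp : ∀ b ∈ M, 0 < dg F b) (hdeg : ∀ b ∈ M, ∀ u, u ∉ M → dg F u ≤ dg F b + 1)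
    (hN : 2 * m + 1 ≤ (univ.filter (fun v => 0 < dg F v)).card) :
    ∃ F', SameDeg F F' ∧ ∃ S, HasCyc F' S ∧ S.card = 2 * m + 1 ∧ m + 1 ≤ (S ∩ M).card := by
  have h3 : ∀ v, 0 < dg F v → 3 ≤ dg F v := fun v hv => by have := hpos v hv; omega
  obtain ⟨F1, hF1, b, hb, b', hb', hbb⟩ := start_edge (by omega) hMp h3 hdeg
  obtain ⟨F2, hF2, a, ha, c, hc, e, hac, hce, hae⟩ := start_tri (F := F1) (M := M) (by omega)
    (fun b hb => by rw [← hF1 b]; exact hMp b hb) (fun v => by rw [← hF1 v]; exact h3 v)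
    (fun b hb u hu => by rw [← hF1 b, ← hF1 u]; exact hdeg b hb u hu) hb hb' hbb
  have hF := hF1.tr hF2
  have hc3 := card_tri hac hce hae
  have h2 : 2 ≤ (({a, c, e} : Finset V) ∩ M).card := by
    have : ({a, c} : Finset V) ⊆ ({a, c, e} : Finset V) ∩ M := by
      intro z hz
      simp only [mem_insert, mem_singleton, mem_inter] at hz ⊢
      rcases hz with rfl | rfl <;> simp [*]
    have := card_le_card this
    rwa [card_pair hac.ne] at this
  obtain ⟨F3, hF3, S3, h31, h32, h33⟩ := gain_iter hm hM (m + 1) F2 {a, c, e} (tri_cyc hac hce hae).hc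
    (by omega) (by omega) (by omega) (fun v => by rw [← hF v]; exact hpos v)
      (fun b hb => by rw [← hF b]; exact hMp b hb)
      (fun b hb u hu => by rw [← hF b, ← hF u]; exact hdeg b hb u hu)
  have hF' := hF.tr hF3
  obtain ⟨F4, hF4, S4, h41, h42, h43⟩ := grow (N0 := 2 * m + 1) hm a le_rfl (2 * m + 1 - S3.card)
    F3 S3 h31 (by omega)
    (by
        have : (fun v => 0 < dg F3 v) = (fun v => 0 < dg F v) := by
          funext v; rw [hF' v]
        simp only [this]; exact hN)
    (fun v => by rw [← hF' v]; exact fun h => Or.inl (hpos v h))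
  refine ⟨F4, hF'.tr hF4, S4, h42, h43, h32.trans (card_le_card ?_)⟩
  exact inter_subset_inter_right h41

end gain
end DSeq

namespace DSeq
set_option linter.unusedSectionVars false
set_option linter.unusedVariables false
open Finset
section posa
variable {V : Type*} [Fintype V] [DecidableEq V]

theorem Pth.close {G : SimpleGraph V} {Q : List V} {a b : V} (h : Pth G Q a b) (hab : G.Adj a b)
    (h3 : 3 ≤ Q.length) : ∃ p P, CycAt G Q.toFinset a p b P ∧ Q.length = P.length + 1 := by
  rcases Q with _ | ⟨c, _ | ⟨p, P⟩⟩
  · simp at h3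
  · simp at h3
  · have h1 := h.hd
    simp at h1
    subst h1
    have hch := h.ch
    have hnd := h.nd
    have hlt := h.lt
    rw [List.getLast?_cons_cons] at hlt
    rw [List.isChain_cons_cons] at hch
    rw [List.nodup_cons] at hnd
    have hP : Pth G (p :: P) p b := ⟨hch.2, hnd.2, rfl, hlt⟩
    exact ⟨p, p :: P, ⟨hP, hnd.1, hP.ne_of_len (by simpa using h3), hch.1, hab, by simp⟩, rfl⟩

theorem CycAt.len {G : SimpleGraph V} {S : Finset V} {u p q : V} {P : List V}
    (h : CycAt G S u p q P) : hasCycleOfLength G (P.length + 1) :=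
  hasCycleOfLength_of_pth h.pth h.nu h.ne h.up h.uq

theorem crossing {G : SimpleGraph V} (f : ℕ → V) (N e p : ℕ)
    (hadj : ∀ j, j + 1 < N → G.Adj (f j) (f (j + 1)))
    (hinj : ∀ j j', j < N → j' < N → f j = f j' → j = j') (hep : e < p) (hp : p < N)
    (h1 : G.Adj (f e) (f (N - 1))) :
    ∃ Q : List V, Pth G Q (f 0) (f p) ∧ Q.length = e + 1 + (N - p) ∧
      ∀ j, j < N → (j ≤ e ∨ p ≤ j) → f j ∈ Q := by
  have hA := seg (G := G) f 0 e (fun j _ h => hadj j (by omega))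
    (fun j j' _ h _ h' => hinj j j' (by omega) (by omega))
  have hB := (seg (G := G) f p (N - 1 - p) (fun j _ h => hadj j (by omega))
    (fun j j' _ h _ h' => hinj j j' (by omega) (by omega))).rev
  rw [Nat.zero_add] at hA
  rw [show p + (N - 1 - p) = N - 1 by omega] at hB
  refine ⟨_, hA.append hB h1 ?_, ?_, ?_⟩
  · intro x hx hx'
    simp only [List.mem_map, List.mem_range, List.mem_reverse] at hx hx'
    obtain ⟨j, hj, rfl⟩ := hx
    obtain ⟨j', hj', he⟩ := hx'
    have := hinj _ _ (by omega) (by omega) he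
    omega
  · simp; omega
  · intro j hj hj'
    simp only [List.mem_append, List.mem_map, List.mem_range, List.mem_reverse]
    rcases hj' with h | h
    · exact Or.inl ⟨j, by omega, by rw [Nat.zero_add]⟩
    · exact Or.inr ⟨j - p, by omega, by congr 1; omega⟩

theorem bondy {F : SimpleGraph V} {W : Finset V} (hW : HasCyc F W) (hsup : ∀ v, v ∉ W → dg F v = 0)
    (hsum : W.card ^ 2 < 2 * ∑ v ∈ W, dg F v) {r : ℕ} (hr : 3 ≤ r) (hrN : r ≤ W.card) :
    hasCycleOfLength F r := by
  classical
  obtain ⟨u, p, q, P, h⟩ := hW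
  have h3 := h.card3
  obtain ⟨f0, g1, g2, g3, g4, g5, -⟩ := h.fn
  set N := W.card with hN
  have hsum' : ∑ v ∈ W, dg F v = ∑ i ∈ range N, dg F (f0 i) := by
    have : W = (range N).image f0 := by
      ext v
      simp only [mem_image, mem_range]
      exact ⟨fun hv => g5 v hv, by rintro ⟨i, _, rfl⟩; exact g4 i⟩
    conv_lhs => rw [this]
    rw [sum_image]
    intro i hi j hj hij
    have := g2 i j hij
    simp only [coe_range, Set.mem_Iio] at hi hj
    rwa [Nat.mod_eq_of_lt hi, Nat.mod_eq_of_lt hj] at this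
  have hsum2 : ∑ i ∈ range N, dg F (f0 (i + 1)) = ∑ i ∈ range N, dg F (f0 i) := by
    have e1 := sum_range_succ (fun i => dg F (f0 i)) N
    have e2 := sum_range_succ' (fun i => dg F (f0 i)) N
    have e3 : f0 N = f0 0 := by have := g3 N; simpa using this.symm
    rw [e3] at e1
    omega
  obtain ⟨i, hi, hdi⟩ : ∃ i ∈ range N, N < dg F (f0 i) + dg F (f0 (i + 1)) := by
    by_contra hh
    push Not at hh
    have := sum_le_sum hh
    rw [sum_add_distrib, hsum2, sum_const, card_range, smul_eq_mul, ← hsum'] at this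
    nlinarith
  -- re-index
  obtain ⟨f, hf⟩ : ∃ f : ℕ → V, f = fun j => f0 (i + 1 + j) := ⟨_, rfl⟩
  have hadj : ∀ j, F.Adj (f j) (f (j + 1)) := by
    intro j; rw [hf]; exact g1 (i + 1 + j)
  have hinj : ∀ j j', j < N → j' < N → f j = f j' → j = j' := by
    intro j j' hj hj' he
    rw [hf] at he
    have h1 : (i + 1 + j) ≡ (i + 1 + j') [MOD N] := g2 _ _ he
    have h2 := Nat.ModEq.add_left_cancel' (i + 1) h1
    unfold Nat.ModEq at h2
    rwa [Nat.mod_eq_of_lt hj, Nat.mod_eq_of_lt hj'] at h2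
  have hf0 : f 0 = f0 (i + 1) := by rw [hf]
  have hfN : f (N - 1) = f0 i := by
    rw [hf]
    show f0 (i + 1 + (N - 1)) = f0 i
    rw [show i + 1 + (N - 1) = i + N by omega, ← g3 (i + N), Nat.add_mod_right, g3]
  have hsurj : ∀ v ∈ W, ∃ j < N, f j = v := by
    have : (range N).image f = W := by
      apply eq_of_subset_of_card_le
      · intro v hv
        obtain ⟨j, _, rfl⟩ := mem_image.1 hv
        rw [hf]; exact g4 _
      · rw [card_image_of_injOn, card_range]
        intro j hj j' hj' he
        simp only [coe_range, Set.mem_Iio] at hj hj'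
        exact hinj j j' hj hj' he
    intro v hv
    rw [← this] at hv
    obtain ⟨j, hj, rfl⟩ := mem_image.1 hv
    exact ⟨j, mem_range.1 hj, rfl⟩
  have hyx : F.Adj (f (N - 1)) (f 0) := by rw [hf0, hfN]; exact g1 i
  rw [← hf0, ← hfN] at hdi
  have hinW : ∀ v w, F.Adj v w → w ∈ W := by
    intro v w hvw
    by_contra hw
    exact (dg_eq_zero.1 (hsup w hw)) v hvw.symm
  -- the index sets
  have hcx : dg F (f 0) ≤ ((Ico 1 (N - 1)).filter (fun p => F.Adj (f 0) (f p))).card + 1 := by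
    have : nb F (f 0) ⊆ insert (f (N - 1))
        (((Ico 1 (N - 1)).filter (fun p => F.Adj (f 0) (f p))).image f) := by
      intro v hv
      rw [mem_nb] at hv
      obtain ⟨j, hj, rfl⟩ := hsurj v (hinW _ _ hv)
      rw [mem_insert, mem_image]
      by_cases hjN : j = N - 1
      · left; rw [hjN]
      · right
        refine ⟨j, ?_, rfl⟩
        rw [mem_filter, mem_Ico]
        refine ⟨⟨?_, by omega⟩, hv⟩
        rcases Nat.eq_zero_or_pos j with h | h
        · subst h; exact absurd rfl hv.ne
        · exact h
    have h1 := card_le_card this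
    have h2 := card_insert_le (f (N - 1))
      (((Ico 1 (N - 1)).filter (fun p => F.Adj (f 0) (f p))).image f)
    have h3 := card_image_le (s := ((Ico 1 (N - 1)).filter (fun p => F.Adj (f 0) (f p)))) (f := f)
    unfold dg
    omega
  have hcy : dg F (f (N - 1)) ≤
      ((Ico 1 (N - 1)).filter (fun p => F.Adj (f (N - 1)) (f p))).card + 1 := by
    have : nb F (f (N - 1)) ⊆ insert (f 0)
        (((Ico 1 (N - 1)).filter (fun p => F.Adj (f (N - 1)) (f p))).image f) := by
      intro v hv
      rw [mem_nb] at hv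
      obtain ⟨j, hj, rfl⟩ := hsurj v (hinW _ _ hv)
      rw [mem_insert, mem_image]
      by_cases hj0 : j = 0
      · left; rw [hj0]
      · right
        refine ⟨j, ?_, rfl⟩
        rw [mem_filter, mem_Ico]
        refine ⟨⟨by omega, ?_⟩, hv⟩
        by_contra hh
        have : j = N - 1 := by omega
        subst this
        exact absurd rfl hv.ne
    have h1 := card_le_card this
    have h2 := card_insert_le (f 0)
      (((Ico 1 (N - 1)).filter (fun p => F.Adj (f (N - 1)) (f p))).image f)
    have h3 := card_image_le
      (s := ((Ico 1 (N - 1)).filter (fun p => F.Adj (f (N - 1)) (f p)))) (f := f)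
    unfold dg
    omega
  obtain ⟨A, hA⟩ : ∃ A, A = (Ico 1 (N - 1)).filter (fun p => F.Adj (f 0) (f p)) := ⟨_, rfl⟩
  obtain ⟨B, hB⟩ : ∃ B, B = (Ico 1 (N - 1)).filter (fun p => F.Adj (f (N - 1)) (f p)) := ⟨_, rfl⟩
  obtain ⟨g, hg⟩ : ∃ g : ℕ → ℕ, g = fun p => if p + r - 3 ≤ N - 2 then p + r - 3 else p + r - 1 - N :=
    ⟨_, rfl⟩
  have hgA : (A.image g).card = A.card := by
    apply card_image_of_injOn
    intro a ha b hb hab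
    rw [hA] at ha hb
    simp only [coe_filter, mem_Ico, Set.mem_ofPred_eq] at ha hb
    simp only [hg] at hab
    split_ifs at hab <;> omega
  have hsubI : A.image g ∪ B ⊆ Ico 1 (N - 1) := by
    intro a ha
    rw [mem_union, mem_image] at ha
    rcases ha with ⟨b, hb, rfl⟩ | ha
    · rw [hA] at hb
      simp only [mem_filter, mem_Ico] at hb
      rw [mem_Ico]
      simp only [hg]
      split_ifs <;> omega
    · rw [hB] at ha; exact (mem_filter.1 ha).1
  obtain ⟨z, hzA, hzB⟩ : ∃ z, z ∈ A.image g ∧ z ∈ B := by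
    by_contra hh
    push Not at hh
    have h1 := card_le_card hsubI
    rw [card_union_of_disjoint (disjoint_left.2 hh), hgA, Nat.card_Ico] at h1
    rw [← hA] at hcx
    rw [← hB] at hcy
    omega
  obtain ⟨p, hp, rfl⟩ := mem_image.1 hzA
  rw [hA] at hp
  rw [hB] at hzB
  simp only [mem_filter, mem_Ico] at hp hzB
  by_cases hpr : p + r - 3 ≤ N - 2
  · have hgp : g p = p + r - 3 := by simp only [hg]; rw [if_pos hpr]
    rw [hgp] at hzB
    have hs := seg (G := F) f p (r - 3) (fun j _ _ => hadj j)
      (fun j j' _ h _ h' => hinj j j' (by omega) (by omega))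
    rw [show p + (r - 3) = p + r - 3 by omega] at hs
    have hs2 := hs.append (Pth.single (G := F) (f (N - 1))) hzB.2.symm (by
      intro x hx hx'
      simp only [List.mem_map, List.mem_range, List.mem_singleton] at hx hx'
      obtain ⟨j, hj, rfl⟩ := hx
      have := hinj _ _ (by omega) (by omega) hx'
      omega)
    have := hasCycleOfLength_of_pth hs2 (u := f 0) (by
      simp only [List.mem_append, List.mem_map, List.mem_range, List.mem_singleton, not_or]
      constructor
      · rintro ⟨j, hj, he⟩
        have := hinj _ _ (by omega) (by omega) he
        omega
      · intro he
        have := hinj _ _ (by omega) (by omega) he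
        omega) (by
      intro he
      have := hinj _ _ (by omega) (by omega) he
      omega) hp.2 hyx.symm
    simp only [List.length_append, List.length_map, List.length_range, List.length_singleton] at this
    rwa [show r - 3 + 1 + 1 + 1 = r by omega] at this
  · have hgp : g p = p + r - 1 - N := by simp only [hg]; rw [if_neg hpr]
    rw [hgp] at hzB
    obtain ⟨Q, hQ, hlen, -⟩ := crossing f N (p + r - 1 - N) p (fun j _ => hadj j) hinj (by omega)
      (by omega) hzB.2.symm
    have hQr : Q.length = r := by omega
    obtain ⟨p', P', hc, hl⟩ := hQ.close hp.2 (by omega)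
    rw [← hQr, hl]
    exact hc.len

theorem dg_mono {F G : SimpleGraph V} (h : F ≤ G) (v : V) : dg F v ≤ dg G v := by
  apply card_le_card
  intro w hw
  rw [mem_nb] at hw ⊢
  exact h hw

theorem posa {F : SimpleGraph V} {W : Finset V} {m : ℕ} (hsup : ∀ v w, F.Adj v w → v ∈ W)
    (hW : W.card = 2 * m + 2) (hm : 1 ≤ m)
    (hP : ∀ i, 1 ≤ i → i ≤ m → 2 * m + 3 - i ≤ (W.filter (fun v => i + 1 ≤ dg F v)).card) :
    HasCyc F W := by
  classical
  by_contra hcon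
  obtain ⟨G, hFG, hG⟩ := Set.Finite.exists_le_maximal
    (s := {G : SimpleGraph V | (∀ v w, G.Adj v w → v ∈ W) ∧ ¬ HasCyc G W}) (a := F)
    (Set.toFinite _) ⟨hsup, hcon⟩
  obtain ⟨⟨hGs, hGn⟩, hGm⟩ := hG
  obtain ⟨N, hN⟩ : ∃ N, N = W.card := ⟨_, rfl⟩
  have hPG : ∀ i, 1 ≤ i → i ≤ m → 2 * m + 3 - i ≤ (W.filter (fun v => i + 1 ≤ dg G v)).card := by
    intro i h1 h2
    refine (hP i h1 h2).trans (card_le_card ?_)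
    intro v hv
    rw [mem_filter] at hv ⊢
    exact ⟨hv.1, hv.2.trans (dg_mono hFG v)⟩
  have hne : ((W ×ˢ W).filter (fun z => z.1 ≠ z.2 ∧ ¬ G.Adj z.1 z.2)).Nonempty := by
    rw [nonempty_iff_ne_empty]
    intro he
    have hall : ∀ a ∈ W, ∀ b ∈ W, a ≠ b → G.Adj a b := by
      intro a ha b hb hab
      by_contra hh
      have : (a, b) ∈ ((W ×ˢ W).filter (fun z => z.1 ≠ z.2 ∧ ¬ G.Adj z.1 z.2)) := by
        simp [ha, hb, hab, hh]
      rw [he] at this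
      simp at this
    have hlen : W.toList.length = 2 * m + 2 := by rw [length_toList, hW]
    have hne : W.toList ≠ [] := by intro h; rw [h] at hlen; simp at hlen
    have hpw : W.toList.Pairwise G.Adj := by
      have := W.nodup_toList
      rw [List.Nodup] at this
      refine List.Pairwise.imp_of_mem ?_ this
      intro a b ha hb hab
      exact hall a (mem_toList.1 ha) b (mem_toList.1 hb) hab
    have hp : Pth G W.toList (W.toList.head hne) (W.toList.getLast hne) :=
      ⟨hpw.isChain, W.nodup_toList, List.head?_eq_some_head hne, List.getLast?_eq_some_getLast hne⟩
    obtain ⟨p, P, hc, -⟩ := hp.close (hall _ (mem_toList.1 hp.mem_hd) _ (mem_toList.1 hp.mem_lt)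
      (hp.ne_of_len (by omega))) (by omega)
    rw [toList_toFinset] at hc
    exact hGn hc.hc
  obtain ⟨⟨x0, y0⟩, hz, hmax⟩ := exists_max_image _ (fun z => dg G z.1 + dg G z.2) hne
  obtain ⟨x, y, hx, hy, hxy, hnadj, hle, hmaxy⟩ : ∃ x y, x ∈ W ∧ y ∈ W ∧ x ≠ y ∧ ¬ G.Adj x y ∧
      dg G x ≤ dg G y ∧ ∀ v ∈ W, v ≠ y → ¬ G.Adj v y → dg G v ≤ dg G x := by
    simp only [mem_filter, mem_product] at hz
    have hmax' : ∀ a ∈ W, ∀ b ∈ W, a ≠ b → ¬ G.Adj a b → dg G a + dg G b ≤ dg G x0 + dg G y0 := by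
      intro a ha b hb hab hh
      exact hmax (a, b) (by simp [ha, hb, hab, hh])
    rcases le_total (dg G x0) (dg G y0) with h | h
    · refine ⟨x0, y0, hz.1.1, hz.1.2, hz.2.1, hz.2.2, h, ?_⟩
      intro v hv h1 h2
      have := hmax' v hv y0 hz.1.2 h1 h2
      omega
    · refine ⟨y0, x0, hz.1.2, hz.1.1, hz.2.1.symm, fun h => hz.2.2 h.symm, h, ?_⟩
      intro v hv h1 h2
      have := hmax' v hv x0 hz.1.1 h1 h2
      omega
  -- Hamiltonian path
  obtain ⟨L, hL, hLW⟩ : ∃ L, Pth G L x y ∧ L.toFinset = W := by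
    have hcyc : HasCyc (G ⊔ SimpleGraph.edge x y) W := by
      by_contra hh
      have hle := hGm (y := G ⊔ SimpleGraph.edge x y) ⟨?_, hh⟩ le_sup_left
      · apply hnadj
        apply hle
        rw [SimpleGraph.sup_adj, SimpleGraph.edge_adj]
        exact Or.inr ⟨Or.inl ⟨rfl, rfl⟩, hxy⟩
      · intro v w hvw
        rw [SimpleGraph.sup_adj, SimpleGraph.edge_adj] at hvw
        rcases hvw with h | ⟨⟨rfl, rfl⟩ | ⟨rfl, rfl⟩, _⟩
        · exact hGs v w h
        · exact hx
        · exact hy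
    have main : ∀ p q P, CycAt (G ⊔ SimpleGraph.edge x y) W x p q P → q = y → 
        ∃ L, Pth G L x y ∧ L.toFinset = W := by
      rintro p q P h rfl
      have hk : ∀ s ∈ P, ∀ t ∈ P, (G ⊔ SimpleGraph.edge x q).Adj s t → G.Adj s t := by
        intro s hs t ht hst
        rw [SimpleGraph.sup_adj, SimpleGraph.edge_adj] at hst
        rcases hst with h' | ⟨⟨rfl, rfl⟩ | ⟨rfl, rfl⟩, _⟩
        · exact h'
        · exact absurd hs h.nu
        · exact absurd ht h.nu
      refine ⟨x :: P, (h.pth.mono hk).cons ?_ h.nu, by simpa using h.eqS⟩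
      have := h.up
      rw [SimpleGraph.sup_adj, SimpleGraph.edge_adj] at this
      have := h.ne
      grind
    obtain ⟨p, q, P, h⟩ := hcyc.at hx
    by_cases hq : q = y
    · exact main p q P h hq
    by_cases hp : p = y
    · exact main q p _ h.rev hp
    exfalso
    apply hGn
    refine (h.mono (G' := G) ?_ ?_ ?_).hc
    · intro s hs t ht hst
      rw [SimpleGraph.sup_adj, SimpleGraph.edge_adj] at hst
      rcases hst with h' | ⟨⟨rfl, rfl⟩ | ⟨rfl, rfl⟩, _⟩
      · exact h'
      · exact absurd hs h.nu
      · exact absurd ht h.nu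
    · have := h.up
      rw [SimpleGraph.sup_adj, SimpleGraph.edge_adj] at this
      grind
    · have := h.uq
      rw [SimpleGraph.sup_adj, SimpleGraph.edge_adj] at this
      grind
  have hLl : L.length = N := by
    rw [hN, ← hLW, List.toFinset_card_of_nodup hL.nd]
  obtain ⟨f, hf⟩ : ∃ f : ℕ → V, f = fun i => L.getD i x := ⟨_, rfl⟩
  have hfi : ∀ i (h : i < N), f i = L[i]'(by omega) := by
    intro i h
    rw [hf]
    exact List.getD_eq_getElem _ _ _
  have hadj : ∀ j, j + 1 < N → G.Adj (f j) (f (j + 1)) := by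
    intro j hj
    rw [hfi j (by omega), hfi (j + 1) hj]
    exact List.isChain_iff_getElem.1 hL.ch j (by omega)
  have hinj : ∀ j j', j < N → j' < N → f j = f j' → j = j' := by
    intro j j' hj hj' he
    rw [hfi j hj, hfi j' hj'] at he
    exact (List.Nodup.getElem_inj_iff hL.nd).1 he
  have hf0 : f 0 = x := by
    rw [hfi 0 (by omega)]
    have := hL.hd
    rw [List.head?_eq_getElem?, List.getElem?_eq_getElem (by omega)] at this
    simpa using this
  have hfN : f (N - 1) = y := by
    rw [hfi (N - 1) (by omega)]
    have := hL.lt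
    rw [List.getLast?_eq_getElem?, List.getElem?_eq_getElem (by omega)] at this
    simpa [hLl] using this
  have hsurj : ∀ v ∈ W, ∃ j < N, f j = v := by
    intro v hv
    rw [← hLW, List.mem_toFinset] at hv
    obtain ⟨j, hj, rfl⟩ := List.mem_iff_getElem.1 hv
    exact ⟨j, by omega, hfi j (by omega)⟩
  have hcross : ∀ j, j + 1 < N → G.Adj x (f (j + 1)) → ¬ G.Adj (f j) y := by
    intro j hj h1 h2
    rw [← hfN] at h2
    obtain ⟨Q, hQ, hlen, hmem⟩ := crossing f N j (j + 1) hadj hinj (by omega) hj h2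
    rw [hf0] at hQ
    obtain ⟨p, P, hc, -⟩ := hQ.close h1 (by omega)
    have : Q.toFinset = W := by
      symm
      apply eq_of_subset_of_card_le
      · intro v hv
        obtain ⟨i, hi, rfl⟩ := hsurj v hv
        rw [List.mem_toFinset]
        exact hmem i hi (by omega)
      · have := List.toFinset_card_le Q
        omega
    rw [this] at hc
    exact hGn hc.hc
  obtain ⟨I, hI⟩ : ∃ I, I = (range (N - 1)).filter (fun j => G.Adj x (f (j + 1))) := ⟨_, rfl⟩
  have hIinj : (I.image f).card = I.card := by
    apply card_image_of_injOn
    intro a ha b hb hab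
    rw [hI] at ha hb
    simp only [coe_filter, mem_range, Set.mem_ofPred_eq] at ha hb
    exact hinj a b (by omega) (by omega) hab
  have hIx : dg G x ≤ I.card := by
    have : nb G x ⊆ I.image (fun j => f (j + 1)) := by
      intro v hv
      rw [mem_nb] at hv
      obtain ⟨j, hj, rfl⟩ := hsurj v (hGs v x hv.symm)
      rw [mem_image]
      have hj0 : j ≠ 0 := by
        rintro rfl
        rw [hf0] at hv; exact hv.ne rfl
      refine ⟨j - 1, ?_, by congr 1; omega⟩
      rw [hI, mem_filter, mem_range, show j - 1 + 1 = j by omega]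
      exact ⟨by omega, hv⟩
    exact (card_le_card this).trans card_image_le
  have hR : ∀ v ∈ I.image f, v ∈ W ∧ v ≠ y ∧ ¬ G.Adj v y := by
    intro v hv
    obtain ⟨j, hj, rfl⟩ := mem_image.1 hv
    rw [hI, mem_filter, mem_range] at hj
    refine ⟨?_, ?_, hcross j (by omega) hj.2⟩
    · exact hGs _ _ (hadj j (by omega))
    · rw [← hfN]
      intro he
      have := hinj _ _ (by omega) (by omega) he
      omega
  have hdy : dg G y + dg G x + 1 ≤ N := by
    have hs : insert y (nb G y ∪ I.image f) ⊆ W := by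
      intro v hv
      rw [mem_insert, mem_union, mem_nb] at hv
      rcases hv with rfl | hv | hv
      · exact hy
      · exact hGs v y hv.symm
      · exact (hR v hv).1
    have h1 := card_le_card hs
    rw [card_insert_of_notMem, card_union_of_disjoint, hIinj] at h1
    · unfold dg at hIx ⊢
      omega
    · rw [disjoint_left]
      intro v hv hv'
      exact (hR v hv').2.2 (mem_nb.1 hv).symm
    · rw [mem_union, mem_nb]
      rintro (h | h)
      · exact h.ne rfl
      · exact (hR y h).2.1 rfl
  have hd1 : 1 ≤ dg G x := by
    have h1 := hPG 1 le_rfl hm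
    have : W.filter (fun v => 1 + 1 ≤ dg G v) = W := by
      apply eq_of_subset_of_card_le (filter_subset _ _)
      omega
    rw [← this, mem_filter] at hx
    omega
  have h1 := hPG (dg G x) hd1 (by omega)
  have hdis : Disjoint (W.filter (fun v => dg G x + 1 ≤ dg G v)) (I.image f) := by
    rw [disjoint_left]
    intro v hv hv'
    obtain ⟨a, b, c⟩ := hR v hv'
    have := hmaxy v a b c
    have := (mem_filter.1 hv).2
    omega
  have h2 : (W.filter (fun v => dg G x + 1 ≤ dg G v)) ∪ (I.image f) ⊆ W :=
    union_subset (filter_subset _ _) (fun v hv => (hR v hv).1)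
  have h3 := card_le_card h2
  rw [card_union_of_disjoint hdis, hIinj] at h3
  omega

end posa
end DSeq

namespace DSeq
set_option linter.unusedSectionVars false
set_option linter.unusedVariables false
open Finset
section induct
variable {V : Type*} [Fintype V] [DecidableEq V]

theorem hasCyc_mono {F G : SimpleGraph V} (h : F ≤ G) {r : ℕ} (hr : hasCycleOfLength F r) :
    hasCycleOfLength G r := by
  obtain ⟨v, c, hc, rfl⟩ := hr
  exact ⟨v, c.mapLe h, (SimpleGraph.Walk.isCycle_mapLe h).2 hc, by simp⟩

theorem finish_wheel {F1 F3 : SimpleGraph V} {x : V} {T S : Finset V} {m : ℕ}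
    (hT : nb F1 x = T) (h : SameDeg (del F1 x) F3) (hS : HasCyc F3 S) (hc : S.card = 2 * m + 1)
    (hST : m + 1 ≤ (S ∩ T).card) :
    ∃ G', SameDeg F1 G' ∧ ∀ r, 3 ≤ r → r ≤ 2 * m + 2 → hasCycleOfLength G' r := by
  obtain ⟨G', hG', hle, hadj⟩ := recombine h
  refine ⟨G', hG', fun r hr hr' => ?_⟩
  have hx : x ∉ S := by
    intro hx
    have := hS.pos hx
    rw [← h x, dg_del_self] at this
    omega
  refine wheel (hS.mono hle) hx ?_ hr (by omega)
  have : S ∩ T ⊆ nb G' x ∩ S := by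
    intro v hv
    rw [mem_inter] at hv ⊢
    refine ⟨?_, hv.1⟩
    rw [mem_nb]
    apply hadj
    rw [← mem_nb, hT]
    exact hv.2
  have := card_le_card this
  omega

theorem dg_del_T {F1 : SimpleGraph V} {x v : V} {T : Finset V} (hT : nb F1 x = T) (hv : v ∈ T) :
    dg (del F1 x) v + 1 = dg F1 v := by
  rw [← hT, mem_nb] at hv
  exact dg_del_of_adj hv

theorem dg_del_nT {F1 : SimpleGraph V} {x v : V} {T : Finset V} (hT : nb F1 x = T) (hv : v ∉ T)
    (hvx : v ≠ x) : dg (del F1 x) v = dg F1 v := by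
  rw [← hT, mem_nb] at hv
  exact dg_del_of_not_adj hvx hv

theorem sum_bound (f : V → ℕ) {U A : Finset V} {B C : ℕ} (hA : A ⊆ U) (h1 : ∀ v ∈ A, f v ≤ B)
    (h2 : ∀ v ∈ U, v ∉ A → f v ≤ C) : ∑ v ∈ U, f v ≤ A.card * B + (U.card - A.card) * C := by
  rw [← sum_sdiff hA, add_comm]
  apply Nat.add_le_add
  · rw [← smul_eq_mul]; exact sum_le_card_nsmul _ _ _ h1
  · rw [← smul_eq_mul, ← card_sdiff_of_subset hA]
    apply sum_le_card_nsmul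
    intro v hv
    rw [mem_sdiff] at hv
    exact h2 v hv.1 hv.2

theorem sum_del {F1 : SimpleGraph V} {x : V} {T W : Finset V} (hT : nb F1 x = T) (hx : x ∈ W)
    (hTW : T ⊆ W.erase x) :
    ∑ v ∈ W.erase x, dg (del F1 x) v + 2 * dg F1 x = ∑ v ∈ W, dg F1 v := by
  rw [← add_sum_erase W _ hx]
  have h1 : ∑ v ∈ W.erase x, (dg (del F1 x) v + if v ∈ T then 1 else 0) =
      ∑ v ∈ W.erase x, dg F1 v := by
    apply sum_congr rfl
    intro v hv
    split_ifs with h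
    · exact dg_del_T hT h
    · exact dg_del_nT hT h (ne_of_mem_erase hv)
  rw [sum_add_distrib, sum_ite_mem, inter_eq_right.2 hTW, sum_const] at h1
  have : T.card = dg F1 x := by rw [← hT]; rfl
  simp only [smul_eq_mul, mul_one] at h1
  omega

theorem repl_deg {F : SimpleGraph V} {S : Finset V} {u b : V}
    (hS : HasCyc F S) (hu : u ∈ S) (hb : b ∉ S) (hd : dg F u ≤ dg F b) :
    ∃ F', SameDeg F F' ∧ HasCyc F' (insert b (S.erase u)) := by
  classical
  obtain ⟨p, q, P, h⟩ := hS.at hu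
  have nbu : b ≠ u := by rintro rfl; exact hb hu
  have nbp : b ≠ p := by rintro rfl; exact hb h.memp
  have nbq : b ≠ q := by rintro rfl; exact hb h.memq
  obtain ⟨Y, hY⟩ : ∃ Y, Y = ((nb F b).erase u) \ nb F u := ⟨_, rfl⟩
  obtain ⟨Mi, hMi⟩ : ∃ Mi : Finset V, Mi = ({p, q} : Finset V) \ nb F b := ⟨_, rfl⟩
  have hYm : ∀ y ∈ Y, F.Adj b y ∧ ¬ F.Adj y u ∧ y ≠ u := by
    intro y hy
    rw [hY, mem_sdiff, mem_erase, mem_nb, mem_nb] at hy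
    exact ⟨hy.1.2, fun h => hy.2 h.symm, hy.1.1⟩
  have hcard : Mi.card ≤ Y.card := by
    have hs : (((nb F b).erase u) ∩ nb F u) ∪ Mi ⊆ nb F u := by
      apply union_subset inter_subset_right
      intro z hz
      rw [hMi, mem_sdiff, mem_insert, mem_singleton] at hz
      rw [mem_nb]
      rcases hz.1 with rfl | rfl
      · exact h.up
      · exact h.uq
    have hdis : Disjoint (((nb F b).erase u) ∩ nb F u) Mi := by
      rw [disjoint_left]
      intro z hz hz'
      rw [hMi, mem_sdiff] at hz'
      rw [mem_inter, mem_erase] at hz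
      exact hz'.2 hz.1.2
    have e1 := card_inter_add_card_sdiff ((nb F b).erase u) (nb F u)
    rw [← hY] at e1
    unfold dg at hd
    by_cases hbu : F.Adj b u
    · have hs' : insert b ((((nb F b).erase u) ∩ nb F u) ∪ Mi) ⊆ nb F u := by
        apply insert_subset _ hs
        rw [mem_nb]; exact hbu.symm
      have h1 := card_le_card hs'
      rw [card_insert_of_notMem, card_union_of_disjoint hdis] at h1
      · rw [card_erase_of_mem (mem_nb.2 hbu)] at e1
        have : 0 < (nb F b).card := card_pos.2 ⟨u, mem_nb.2 hbu⟩
        omega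
      · simp [mem_nb, hMi, nbp, nbq]
    · have h1 := card_le_card hs
      rw [card_union_of_disjoint hdis] at h1
      rw [erase_eq_of_notMem (by rwa [mem_nb])] at e1 h1
      omega
  by_cases hbp : F.Adj b p
  · by_cases hbq : F.Adj b q
    · exact ⟨F, SameDeg.rfl', (h.repl (fun _ _ _ _ h => h) hb hbp hbq).hc⟩
    · have : 0 < Y.card := by
        refine lt_of_lt_of_le (card_pos.2 ⟨q, ?_⟩) hcard
        simp [hMi, mem_nb, hbq]
      obtain ⟨y, hy⟩ := card_pos.1 this
      obtain ⟨h1, h2, h3⟩ := hYm y hy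
      exact repl_one h.rev hb hbp h1 h2 h3
  · by_cases hbq : F.Adj b q
    · have : 0 < Y.card := by
        refine lt_of_lt_of_le (card_pos.2 ⟨p, ?_⟩) hcard
        simp [hMi, mem_nb, hbp]
      obtain ⟨y, hy⟩ := card_pos.1 this
      obtain ⟨h1, h2, h3⟩ := hYm y hy
      exact repl_one h hb hbq h1 h2 h3
    · have hM2 : Mi = {p, q} := by
        rw [hMi]
        apply sdiff_eq_self_of_disjoint
        rw [disjoint_left]
        simp [mem_nb, hbp, hbq]
      rw [hM2, card_pair h.ne] at hcard
      obtain ⟨y, hy, y2, hy2, hyy⟩ := one_lt_card.1 (show 1 < Y.card by omega)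
      obtain ⟨h1, h2, h3⟩ := hYm y hy
      obtain ⟨h4, h5, h6⟩ := hYm y2 hy2
      exact repl_two h hb h1 h2 h3 h4 h5 h6 hyy

theorem repl_iter {Hb : Finset V} (j : ℕ) : ∀ (F : SimpleGraph V) (S : Finset V), HasCyc F S →
    (Hb \ S).card ≤ j → Hb.card ≤ S.card → (∀ b ∈ Hb, ∀ u, u ∉ Hb → dg F u ≤ dg F b) →
    ∃ F', SameDeg F F' ∧ ∃ S', HasCyc F' S' ∧ S'.card = S.card ∧ Hb ⊆ S' := by
  induction j with
  | zero =>
    intro F S hS h0 _ _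
    refine ⟨F, SameDeg.rfl', S, hS, rfl, ?_⟩
    rw [← sdiff_eq_empty_iff_subset, ← card_eq_zero]; omega
  | succ j ih =>
    intro F S hS hj hc hdeg
    by_cases hsub : Hb ⊆ S
    · exact ⟨F, SameDeg.rfl', S, hS, rfl, hsub⟩
    obtain ⟨b, hb, hbS⟩ := not_subset.1 hsub
    obtain ⟨u, hu, huH⟩ : ∃ u ∈ S, u ∉ Hb := by
      by_contra hh
      push Not at hh
      have := eq_of_subset_of_card_le hh hc
      exact hsub this.symm.subset
    obtain ⟨F1, hF1, h1⟩ := repl_deg hS hu hbS (hdeg b hb u huH)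
    have hcard : (insert b (S.erase u)).card = S.card := by
      rw [card_insert_of_notMem (fun h => hbS (mem_of_mem_erase h)), card_erase_of_mem hu]
      have := card_pos.2 ⟨u, hu⟩
      omega
    obtain ⟨F2, hF2, S2, h2, h3, h4⟩ := ih F1 (insert b (S.erase u)) h1 (by
        have : Hb \ insert b (S.erase u) ⊆ (Hb \ S).erase b := by
          intro z hz
          simp only [mem_sdiff, mem_insert, mem_erase, not_or, not_and] at hz ⊢
          grind
        have h5 := card_le_card this
        rw [card_erase_of_mem (mem_sdiff.2 ⟨hb, hbS⟩)] at h5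
        omega) (by omega)
      (fun b hb u hu => by rw [← hF1 b, ← hF1 u]; exact hdeg b hb u hu)
    exact ⟨F2, hF1.tr hF2, S2, h2, by omega, h4⟩

theorem dg_le {F : SimpleGraph V} {W : Finset V} (hsup : ∀ v, v ∉ W → dg F v = 0) {v : V}
    (hv : v ∈ W) : dg F v ≤ W.card - 1 := by
  rw [← card_erase_of_mem hv]
  apply card_le_card
  intro w hw
  rw [mem_nb] at hw
  rw [mem_erase]
  refine ⟨hw.ne', ?_⟩
  by_contra h
  exact dg_eq_zero.1 (hsup w h) v hw.symm

/-- case beta -/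
theorem case_beta {F1 : SimpleGraph V} {W T : Finset V} {x : V} {m : ℕ} (hm : 2 ≤ m)
    (hsup : ∀ v, v ∉ W → dg F1 v = 0) (hW : 2 * m + 2 ≤ W.card) (hx : x ∈ W)
    (hmin : ∀ v ∈ W, m + 1 ≤ dg F1 v) (hT : nb F1 x = T) (hTc : m + 1 ≤ T.card) 
    (hTW : T ⊆ W.erase x)
    (htop : ∀ t ∈ T, ∀ u, u ∉ T → u ≠ x → dg F1 u ≤ dg F1 t) (hT2 : ∀ t ∈ T, m + 2 ≤ dg F1 t) :
    ∃ G', SameDeg F1 G' ∧ ∀ r, 3 ≤ r → r ≤ 2 * m + 2 → hasCycleOfLength G' r := by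
  have hin : ∀ v ∈ W.erase x, m + 1 ≤ dg (del F1 x) v := by
    intro v hv
    by_cases hvT : v ∈ T
    · have := dg_del_T hT hvT
      have := hT2 v hvT
      omega
    · rw [dg_del_nT hT hvT (ne_of_mem_erase hv)]
      exact hmin v (mem_of_mem_erase hv)
  have hout : ∀ v, v ∉ W.erase x → dg (del F1 x) v = 0 := by
    intro v hv
    by_cases hvx : v = x
    · rw [hvx, dg_del_self]
    · have hvT : v ∉ T := fun h => hv (hTW h)
      rw [dg_del_nT hT hvT hvx]
      apply hsup
      intro h
      exact hv (mem_erase.2 ⟨hvx, h⟩)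
  obtain ⟨F3, hF3, S, hS, hSc, hST⟩ := theoremB (F := del F1 x) (M := T) hm hTc (by
    intro v hv
    by_contra hh
    have : v ∉ W.erase x := fun h => hh (hin v h)
    rw [hout v this] at hv
    omega) (by
    intro b hb
    have := hin b (hTW hb)
    omega) (by
    intro b hb u hu
    by_cases hux : u = x
    · rw [hux, dg_del_self]; omega
    · rw [dg_del_nT hT hu hux, dg_del_T hT hb]
      exact htop b hb u hu hux) (by
    have : W.erase x ⊆ univ.filter (fun v => 0 < dg (del F1 x) v) := by
      intro v hv
      rw [mem_filter]
      have := hin v hv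
      exact ⟨mem_univ _, by omega⟩
    have := card_le_card this
    rw [card_erase_of_mem hx] at this
    omega)
  exact finish_wheel hT hF3 hS hSc hST

/-- case gamma -/
theorem case_gamma {F1 : SimpleGraph V} {W T : Finset V} {x y : V} {m : ℕ} (hm : 2 ≤ m)
    (hsup : ∀ v, v ∉ W → dg F1 v = 0) (hW : 2 * m + 3 ≤ W.card) (hx : x ∈ W)
    (hT : nb F1 x = T) (hTc : T.card = m + 1) (hTW : T ⊆ W.erase x) (hy : y ∈ T)
    (hyd : dg F1 y = m + 1) (hrest : ∀ v ∈ W, v ∉ T → dg F1 v = m + 1)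
    (hhub : ∀ h ∈ T.erase y, m + 3 ≤ dg F1 h) :
    ∃ G', SameDeg F1 G' ∧ ∀ r, 3 ≤ r → r ≤ 2 * m + 2 → hasCycleOfLength G' r := by
  classical
  obtain ⟨G1, hG1⟩ : ∃ G1, G1 = del F1 x := ⟨_, rfl⟩
  obtain ⟨Hb, hHb⟩ : ∃ Hb, Hb = T.erase y := ⟨_, rfl⟩
  rw [← hHb] at hhub
  have hxT : x ∉ T := fun h => (mem_erase.1 (hTW h)).1 rfl
  have hyx : y ≠ x := by rintro rfl; exact hxT hy
  have hyW : y ∈ W := mem_of_mem_erase (hTW hy)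
  have hHbT : ∀ h ∈ Hb, h ∈ T := fun h hh => by rw [hHb] at hh; exact mem_of_mem_erase hh
  have hyH : y ∉ Hb := by rw [hHb]; simp
  have hHc : Hb.card = m := by rw [hHb, card_erase_of_mem hy, hTc]; rfl
  have d1y : dg G1 y = m := by
    have := dg_del_T hT hy
    rw [hG1]; omega
  have d1h : ∀ h ∈ Hb, m + 2 ≤ dg G1 h := by
    intro h hh
    have := dg_del_T hT (hHbT h hh)
    have := hhub h hh
    rw [hG1]; omega
  have d1r : ∀ v ∈ W, v ≠ x → v ≠ y → v ∉ Hb → dg G1 v = m + 1 := by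
    intro v hv hvx hvy hvH
    have hvT : v ∉ T := by
      intro h
      apply hvH
      rw [hHb]; exact mem_erase.2 ⟨hvy, h⟩
    rw [hG1, dg_del_nT hT hvT hvx]
    exact hrest v hv hvT
  have d1o : ∀ v, v ∉ W → dg G1 v = 0 := by
    intro v hv
    have hvx : v ≠ x := by rintro rfl; exact hv hx
    rw [hG1, dg_del_nT hT (fun h => hv (mem_of_mem_erase (hTW h))) hvx]
    exact hsup v hv
  have d1x : dg G1 x = 0 := by rw [hG1, dg_del_self]
  have d1u : ∀ u, u ∉ Hb → dg G1 u ≤ m + 1 := by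
    intro u hu
    by_cases h1 : u = x
    · rw [h1, d1x]; omega
    by_cases h2 : u = y
    · rw [h2, d1y]; omega
    by_cases h3 : u ∈ W
    · rw [d1r u h3 h1 h2 hu]
    · rw [d1o u h3]; omega
  obtain ⟨H1, hH1, hn1⟩ := kleitman_wang (G := G1) (x := y) (T := Hb) hyH (by rw [hHc, d1y]) (by
    intro t ht u hu _
    have := d1h t ht
    have := d1u u hu
    omega)
  obtain ⟨G2, hG2⟩ : ∃ G2, G2 = del H1 y := ⟨_, rfl⟩
  have d2y : dg G2 y = 0 := by rw [hG2, dg_del_self]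
  have d2h : ∀ h ∈ Hb, m + 1 ≤ dg G2 h := by
    intro h hh
    have e1 := dg_del_T hn1 hh
    have e2 := d1h h hh
    rw [hH1 h] at e2
    rw [hG2]; omega
  have d2u : ∀ u, u ∉ Hb → u ≠ y → dg G2 u = dg G1 u := by
    intro u hu huy
    rw [hG2, dg_del_nT hn1 hu huy, hH1 u]
  have d2pos : ∀ v, 0 < dg G2 v → m + 1 ≤ dg G2 v := by
    intro v hv
    by_cases h0 : v ∈ Hb
    · exact d2h v h0
    have h2 : v ≠ y := by rintro rfl; omega
    rw [d2u v h0 h2] at hv ⊢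
    have h1 : v ≠ x := by rintro rfl; omega
    by_cases h3 : v ∈ W
    · rw [d1r v h3 h1 h2 h0]
    · rw [d1o v h3] at hv; omega
  have d2W : ∀ v ∈ (W.erase x).erase y, 0 < dg G2 v := by
    intro v hv
    rw [mem_erase, mem_erase] at hv
    by_cases h0 : v ∈ Hb
    · have := d2h v h0; omega
    · rw [d2u v h0 hv.1, d1r v hv.2.2 hv.2.1 hv.1 h0]; omega
  have c2 : 2 * m + 1 ≤ ((W.erase x).erase y).card := by
    rw [card_erase_of_mem (hTW hy), card_erase_of_mem hx]; omega
  have c2' : 2 * m + 1 ≤ (univ.filter (fun v => 0 < dg G2 v)).card :=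
    c2.trans (card_le_card (fun v hv => mem_filter.2 ⟨mem_univ _, d2W v hv⟩))
  obtain ⟨v0, hv0⟩ : ((W.erase x).erase y).Nonempty := card_pos.1 (by omega)
  obtain ⟨A1, hA1, S1, hS1c, hS1⟩ := triangle (F := G2)
    (fun v hv => by have := d2pos v hv; omega) ⟨v0, d2W v0 hv0⟩
  obtain ⟨A2, hA2, S2, -, hS2, hS2c⟩ := grow (N0 := 2 * m - 1) hm x (by omega) (2 * m - 1 - 3)
    A1 S1 hS1 (by omega)
    (by
      have : (fun v => 0 < dg A1 v) = (fun v => 0 < dg G2 v) := by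
        funext v; rw [hA1 v]
      simp only [this]; omega)
    (fun v => by rw [← hA1 v]; exact fun h => Or.inl (d2pos v h))
  have hA12 := hA1.tr hA2
  obtain ⟨A3, hA3, S3, hS3, hS3c, hHS3⟩ := repl_iter (Hb := Hb) _ A2 S2 hS2 le_rfl (by omega) (by
    intro b hb u hu
    rw [← hA12 b, ← hA12 u]
    have := d2h b hb
    by_cases huy : u = y
    · rw [huy, d2y]; omega
    · rw [d2u u hu huy]
      have := d1u u hu
      omega)
  have hA123 := hA12.tr hA3
  obtain ⟨u, p, q, P, hcyc, hu, hp⟩ := pigeon (A := fun v => v ∈ Hb) hS3 (by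
    have : Hb ⊆ S3.filter (fun v => v ∈ Hb) := fun v hv => mem_filter.2 ⟨hHS3 hv, hv⟩
    have := card_le_card this
    omega)
  rw [hG2] at hA123
  obtain ⟨B1, hB1, hle, hadj⟩ := recombine hA123
  have hyS3 : y ∉ S3 := by
    intro h
    have := hS3.pos h
    rw [← hA123 y, dg_del_self] at this
    omega
  have hyadj : ∀ h ∈ Hb, B1.Adj y h := by
    intro h hh
    apply hadj
    rw [← mem_nb, hn1]; exact hh
  have hcyc2 := hcyc.ins (fun s _ t _ hst => hle hst) hyS3 (hyadj p hp) (hyadj u hu).symm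
    (hle hcyc.uq)
  have hGB := hH1.tr hB1
  obtain ⟨B2, hB2, S4, hsub, hS4, hS4c⟩ := grow (N0 := 2 * m + 1) hm y le_rfl 1 B1 (insert y S3)
    hcyc2.hc (by rw [card_insert_of_notMem hyS3]; omega) (by
      refine c2.trans (card_le_card (fun v hv => mem_filter.2 ⟨mem_univ _, ?_⟩))
      rw [mem_erase, mem_erase] at hv
      rw [← hGB v]
      by_cases h0 : v ∈ Hb
      · have := d1h v h0; omega
      · rw [d1r v hv.2.2 hv.2.1 hv.1 h0]; omega) (by
      intro v hv
      rw [← hGB v] at hv ⊢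
      by_cases h2 : v = y
      · exact Or.inr ⟨h2, mem_insert_self _ _⟩
      left
      by_cases h0 : v ∈ Hb
      · have := d1h v h0; omega
      have h1 : v ≠ x := by rintro rfl; omega
      by_cases h3 : v ∈ W
      · rw [d1r v h3 h1 h2 h0]
      · rw [d1o v h3] at hv; omega)
  have hfin := hGB.tr hB2
  rw [hG1] at hfin
  refine finish_wheel hT hfin hS4 hS4c ?_
  have : T ⊆ S4 ∩ T := by
    intro v hv
    rw [mem_inter]
    refine ⟨hsub ?_, hv⟩
    by_cases hvy : v = y
    · rw [hvy]; exact mem_insert_self _ _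
    · apply mem_insert_of_mem
      apply hHS3
      rw [hHb]; exact mem_erase.2 ⟨hvy, hv⟩
  have := card_le_card this
  omega

theorem induct {m : ℕ} (hm : 2 ≤ m) (s : ℕ) : ∀ (F : SimpleGraph V) (W : Finset V),
    W.card = 2 * m + 2 + s → (∀ v, v ∉ W → dg F v = 0) →
    (∀ i, 1 ≤ i → i ≤ m → 2 * m + 3 - i ≤ (W.filter (fun v => i + 1 ≤ dg F v)).card) →
    2 * m * W.card + 4 ≤ ∑ v ∈ W, dg F v + m ^ 2 + m →
    ∃ F', SameDeg F F' ∧ ∀ r, 3 ≤ r → r ≤ 2 * m + 2 → hasCycleOfLength F' r := by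
  induction s with
  | zero =>
    intro F W hW hsup hP hX
    refine ⟨F, SameDeg.rfl', fun r hr hr' => ?_⟩
    refine bondy (posa (m := m) ?_ (by omega) (by omega) hP) hsup ?_ hr (by omega)
    · intro v w hvw
      by_contra hh
      exact dg_eq_zero.1 (hsup v hh) w hvw
    · rw [hW] at hX ⊢
      nlinarith
  | succ s ih =>
    intro F W hW hsup hP hX
    obtain ⟨x, hx, hmin⟩ := exists_min_image W (dg F) (card_pos.1 (by omega))
    obtain ⟨T, hTW, hTc, htop⟩ := exists_top (dg F) (W.erase x) (dg F x) (by
      rw [card_erase_of_mem hx]; exact dg_le hsup hx)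
    have hxT : x ∉ T := fun h => (mem_erase.1 (hTW h)).1 rfl
    have htop' : ∀ t ∈ T, ∀ u, u ∉ T → u ≠ x → dg F u ≤ dg F t := by
      intro t ht u hu hux
      by_cases huW : u ∈ W
      · exact htop t ht u (mem_erase.2 ⟨hux, huW⟩) hu
      · rw [hsup u huW]; omega
    obtain ⟨F1, hF1, hn1⟩ := kleitman_wang hxT hTc htop'
    have hsup1 : ∀ v, v ∉ W → dg F1 v = 0 := fun v hv => by rw [← hF1 v]; exact hsup v hv
    by_cases hall : ∀ t ∈ T, m + 2 ≤ dg F t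
    · by_cases hk : dg F x ≤ m
      · -- small minimum degree
        obtain ⟨F', hF', hcyc⟩ := ih (del F1 x) (W.erase x)
          (by rw [card_erase_of_mem hx]; omega)
          (by
            intro v hv
            by_cases hvx : v = x
            · rw [hvx, dg_del_self]
            · rw [dg_del_nT hn1 (fun h => hv (hTW h)) hvx]
              apply hsup1
              intro h
              exact hv (mem_erase.2 ⟨hvx, h⟩))
          (by
            intro i hi1 him
            have hsub : (W.filter (fun v => i + 1 ≤ dg F v)).erase x ⊆
                (W.erase x).filter (fun v => i + 1 ≤ dg (del F1 x) v) := by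
              intro v hv
              simp only [mem_erase, mem_filter] at hv ⊢
              refine ⟨⟨hv.1, hv.2.1⟩, ?_⟩
              by_cases hvT : v ∈ T
              · have e1 := dg_del_T hn1 hvT
                have e2 := hall v hvT
                rw [hF1 v] at e2
                omega
              · rw [dg_del_nT hn1 hvT hv.1, ← hF1 v]
                exact hv.2.2
            have hc := card_le_card hsub
            by_cases hxi : i + 1 ≤ dg F x
            · have : W.filter (fun v => i + 1 ≤ dg F v) = W := by
                rw [filter_eq_self]
                intro v hv
                exact hxi.trans (hmin v hv)
              rw [this, card_erase_of_mem hx] at hc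
              omega
            · have hxn : x ∉ W.filter (fun v => i + 1 ≤ dg F v) := fun h => hxi (mem_filter.1 h).2
              rw [erase_eq_of_notMem hxn] at hc
              exact (hP i hi1 him).trans hc)
          (by
            have e := sum_del hn1 hx hTW
            have e2 : ∑ v ∈ W, dg F1 v = ∑ v ∈ W, dg F v :=
              sum_congr rfl (fun v _ => (hF1 v).symm)
            have e3 : dg F1 x ≤ m := by rw [← hF1 x]; exact hk
            have e4 : (W.erase x).card + 1 = W.card := card_erase_add_one hx
            rw [e2] at e
            rw [← e4] at hX
            nlinarith)
        obtain ⟨G', hG', hle, -⟩ := recombine hF'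
        exact ⟨G', hF1.tr hG', fun r hr hr' => hasCyc_mono hle (hcyc r hr hr')⟩
      · obtain ⟨G', hG', h⟩ := case_beta hm hsup1 (by omega) hx
          (fun v hv => by rw [← hF1 v]; have := hmin v hv; omega) hn1 (by omega) hTW
          (fun t ht u hu hux => by rw [← hF1 t, ← hF1 u]; exact htop' t ht u hu hux)
          (fun t ht => by rw [← hF1 t]; exact hall t ht)
        exact ⟨G', hF1.tr hG', h⟩
    · push Not at hall
      obtain ⟨y, hy, hyd⟩ := hall
      have hyW : y ∈ W := mem_of_mem_erase (hTW hy)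
      have hrest : ∀ v ∈ W, v ∉ T → dg F v ≤ m + 1 := by
        intro v hv hvT
        by_cases hvx : v = x
        · have := hmin y hyW
          rw [hvx]; omega
        · have := htop' y hy v hvT hvx
          omega
      have hkpos : 0 < T.card := card_pos.2 ⟨y, hy⟩
      have hEW : T.erase y ⊆ W := fun v hv => mem_of_mem_erase (hTW (mem_of_mem_erase hv))
      have hEc : (T.erase y).card = dg F x - 1 := by rw [card_erase_of_mem hy, hTc]
      by_cases hk : dg F x ≤ m
      · exfalso
        have hb := sum_bound (dg F) (U := W) (A := T.erase y) (B := W.card - 1) (C := m + 1) hEW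
          (fun v hv => dg_le hsup (hEW hv)) (by
            intro v hv hvE
            by_cases hvy : v = y
            · rw [hvy]; omega
            · exact hrest v hv (fun h => hvE (mem_erase.2 ⟨hvy, h⟩)))
        rw [hEc] at hb
        obtain ⟨a, ha⟩ : ∃ a, dg F x = a + 1 := ⟨dg F x - 1, by omega⟩
        obtain ⟨t, ht⟩ : ∃ t, m = a + 1 + t := ⟨m - (a + 1), by omega⟩
        rw [ha, hW] at hb
        rw [hW] at hX
        rw [show a + 1 - 1 = a by omega, show 2 * m + 2 + (s + 1) - 1 = 2 * m + 2 + s by omega,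
          show 2 * m + 2 + (s + 1) - a = 2 * t + a + 5 + s by omega] at hb
        subst ht
        nlinarith
      · have hyx := hmin y hyW
        have hdx : dg F x = m + 1 := by omega
        obtain ⟨G', hG', h⟩ := case_gamma (y := y) hm hsup1 (by omega) hx hn1 (by omega) hTW hy
          (by rw [← hF1 y]; omega)
          (fun v hv hvT => by
            rw [← hF1 v]
            have := hrest v hv hvT
            have := hmin v hv
            omega)
          (by
            intro h hh
            rw [← hF1 h]
            by_contra hlt
            have hhW := hEW hh
            have hb := sum_bound (dg F) (U := W.erase h) (A := (T.erase y).erase h)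
              (B := W.card - 1) (C := m + 1) (erase_subset_erase _ hEW)
              (fun v hv => dg_le hsup (hEW (mem_of_mem_erase hv))) (by
                intro v hv hvE
                rw [mem_erase] at hv
                by_cases hvy : v = y
                · rw [hvy]; omega
                · exact hrest v hv.2 (fun h' => hvE
                    (mem_erase.2 ⟨hv.1, mem_erase.2 ⟨hvy, h'⟩⟩)))
            have e := add_sum_erase W (dg F) hhW
            rw [card_erase_of_mem hh, card_erase_of_mem hhW, hEc, hdx, hW] at hb
            rw [hW] at hX
            obtain ⟨t, rfl⟩ : ∃ t, m = t + 1 := ⟨m - 1, by omega⟩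
            rw [show t + 1 + 1 - 1 - 1 = t by omega,
              show 2 * (t + 1) + 2 + (s + 1) - 1 = 2 * t + 4 + s by omega,
              show 2 * t + 4 + s - t = t + 4 + s by omega] at hb
            nlinarith)
        exact ⟨G', hF1.tr hG', h⟩

end induct
end DSeq

namespace DSeq
set_option linter.unusedSectionVars false
set_option linter.unusedVariables false
open Finset
section final
variable {V : Type*} [Fintype V] [DecidableEq V]

theorem ncard_nb (G : SimpleGraph V) (v : V) : (G.neighborSet v).ncard = dg G v := by
  unfold dg
  rw [← Set.ncard_coe_finset]
  congr 1
  ext w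
  simp [mem_nb]

theorem erdos_gallai_bound (G : SimpleGraph V) (K : Finset V) (i : ℕ)
    (hi : ∀ v, v ∉ K → dg G v ≤ i) :
    ∑ v, dg G v ≤ K.card * (K.card - 1) + 2 * (i * (Fintype.card V - K.card)) := by
  classical
  have h1 : ∑ v ∈ K, dg G v ≤ ∑ v ∈ K, ((K.card - 1) + (Kᶜ.filter (fun w => G.Adj v w)).card) := by
    apply sum_le_sum
    intro v hv
    have : nb G v ⊆ K.erase v ∪ Kᶜ.filter (fun w => G.Adj v w) := by
      intro w hw
      rw [mem_nb] at hw
      simp only [mem_union, mem_erase, mem_filter, mem_compl]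
      by_cases hwK : w ∈ K
      · exact Or.inl ⟨hw.ne', hwK⟩
      · exact Or.inr ⟨hwK, hw⟩
    have h2 := (card_le_card this).trans (card_union_le _ _)
    rw [card_erase_of_mem hv] at h2
    exact h2
  have h2 : ∑ v ∈ K, (Kᶜ.filter (fun w => G.Adj v w)).card =
      ∑ w ∈ Kᶜ, (K.filter (fun v => G.Adj v w)).card := by
    simp only [card_filter]
    exact sum_comm
  have h3 : ∑ w ∈ Kᶜ, (K.filter (fun v => G.Adj v w)).card ≤ ∑ w ∈ Kᶜ, dg G w := by
    apply sum_le_sum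
    intro w _
    apply card_le_card
    intro v hv
    rw [mem_nb]
    exact (mem_filter.1 hv).2.symm
  have h4 : ∑ w ∈ Kᶜ, dg G w ≤ (Fintype.card V - K.card) * i := by
    rw [← smul_eq_mul, ← card_compl]
    apply sum_le_card_nsmul
    intro v hv
    exact hi v (mem_compl.1 hv)
  have h5 := sum_add_sum_compl K (dg G)
  rw [sum_add_distrib, sum_const, smul_eq_mul, h2] at h1
  nlinarith

theorem arith {m n i σ : ℕ} (hm : 2 ≤ m) (hn : 2 * m + 2 ≤ n) (hi1 : 1 ≤ i) (him : i ≤ m)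
    (h1 : 2 * n + 4 * m ^ 2 ≤ σ + 2 * m) (h2 : 2 * m * n + 4 ≤ σ + m ^ 2 + m)
    (hσ : σ ≤ (2 * m + 2 - i) * (2 * m + 2 - i - 1) + 2 * (i * (n - (2 * m + 2 - i)))) : False := by
  obtain ⟨k, hk⟩ : ∃ k, 2 * m + 2 - i = k + 1 := ⟨2 * m + 1 - i, by omega⟩
  obtain ⟨t, ht⟩ : ∃ t, n - (2 * m + 2 - i) = t := ⟨_, rfl⟩
  rw [ht, hk, Nat.add_sub_cancel] at hσ
  have hk' : (k : ℤ) = 2 * m + 1 - i := by omega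
  have ht' : (t : ℤ) = n - 2 * m - 2 + i := by omega
  zify at h1 h2 hσ hi1 him hm
  rw [hk', ht'] at hσ
  by_cases hc : 3 * (1 + (i : ℤ)) + (2 * n - 8 * m - 7) ≤ 0
  · have := mul_nonneg (show (0 : ℤ) ≤ i - 1 by linarith)
      (show (0 : ℤ) ≤ -(3 * (1 + (i : ℤ)) + (2 * n - 8 * m - 7)) by linarith)
    nlinarith
  · have := mul_nonneg (show (0 : ℤ) ≤ m - i by linarith)
      (show (0 : ℤ) ≤ 3 * ((m : ℤ) + i) + (2 * n - 8 * m - 7) by linarith)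
    nlinarith

end final
end DSeq

/-- **Upper bound argument for `σ(C_{2m+2}, n)`.** Let `m ≥ 2`, `n ≥ 2m+2` and let
`π = (d₁,…,dₙ)` be a non-increasing graphic sequence with
`σ(π) ≥ max{2n + 4m² - 2m - 2, m(2n - m - 1) + 2} + 2`. Then `π` is potentially
`C_{2m+2}`-graphic; moreover `d_{2m+3-i} ≥ i+1` for every `1 ≤ i ≤ m`, so `π` even has a
realization containing cycles of every length from `3` to `2m+2`. -/
theorem sigma_C_even_upper (m n : ℕ) (hm : 2 ≤ m) (hn : 2 * m + 2 ≤ n) (d : Fin n → ℕ)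
    (hanti : Antitone d) (hgr : Graphic d)
    (hσ : max (2 * n + 4 * m ^ 2 - 2 * m - 2) (m * (2 * n - m - 1) + 2) + 2 ≤ ∑ i, d i) :
    PotC (2 * m + 2) d ∧
    (∀ i : ℕ, ∀ _ : 1 ≤ i, ∀ _ : i ≤ m, i + 1 ≤ d ⟨2 * m + 2 - i, by omega⟩) ∧
    Pot3C (2 * m + 2) d := by
  obtain ⟨G, hG⟩ := hgr
  have hdg : ∀ v, DSeq.dg G v = d v := fun v => by rw [← DSeq.ncard_nb]; exact hG v
  have hs : ∑ v, DSeq.dg G v = ∑ v, d v := Finset.sum_congr rfl (fun v _ => hdg v)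
  have h1 : 2 * n + 4 * m ^ 2 ≤ ∑ v, DSeq.dg G v + 2 * m := by
    have := le_max_left (2 * n + 4 * m ^ 2 - 2 * m - 2) (m * (2 * n - m - 1) + 2)
    rw [hs]
    omega
  have h2 : 2 * m * n + 4 ≤ ∑ v, DSeq.dg G v + m ^ 2 + m := by
    have h3 := le_max_right (2 * n + 4 * m ^ 2 - 2 * m - 2) (m * (2 * n - m - 1) + 2)
    rw [hs]
    obtain ⟨t, ht⟩ : ∃ t, 2 * n = t + m + 1 := ⟨2 * n - m - 1, by omega⟩
    rw [show 2 * n - m - 1 = t by omega] at h3 hσ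
    have h4 : m * t + 4 ≤ ∑ i, d i := by omega
    have h5 : 2 * m * n = m * t + m ^ 2 + m := by
      calc 2 * m * n = m * (2 * n) := by ring
        _ = m * t + m ^ 2 + m := by rw [ht]; ring
    omega
  have hP : ∀ i, 1 ≤ i → i ≤ m → 2 * m + 3 - i ≤
      (Finset.univ.filter (fun v => i + 1 ≤ DSeq.dg G v)).card := by
    intro i hi1 him
    by_contra hlt
    obtain ⟨K, hK, hKc⟩ := Finset.exists_superset_card_eq (n := 2 * m + 2 - i)
      (s := Finset.univ.filter (fun v => i + 1 ≤ DSeq.dg G v)) (by omega)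
      (by rw [Fintype.card_fin]; omega)
    have hb := DSeq.erdos_gallai_bound G K i (by
      intro v hv
      by_contra hh
      exact hv (hK (Finset.mem_filter.2 ⟨Finset.mem_univ _, by omega⟩)))
    rw [hKc, Fintype.card_fin] at hb
    exact DSeq.arith hm hn hi1 him h1 h2 hb
  obtain ⟨F, hF, hcyc⟩ := DSeq.induct hm (n - (2 * m + 2)) G Finset.univ
    (by rw [Finset.card_univ, Fintype.card_fin]; omega)
    (fun v hv => absurd (Finset.mem_univ v) hv) hP
    (by rw [Finset.card_univ, Fintype.card_fin]; exact h2)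
  have hFd : IsDegreeSeq F d := by
    intro v
    rw [DSeq.ncard_nb, ← hF v, hdg v]
  refine ⟨⟨F, hFd, hcyc _ (by omega) le_rfl⟩, ?_, ⟨F, hFd, hcyc⟩⟩
  intro i hi1 him
  by_contra hlt
  have h3 := hP i hi1 him
  have h4 : Finset.univ.filter (fun v => i + 1 ≤ DSeq.dg G v) ⊆
      Finset.univ.filter (fun v : Fin n => (v : ℕ) < 2 * m + 2 - i) := by
    intro v hv
    rw [Finset.mem_filter] at hv ⊢
    refine ⟨hv.1, ?_⟩
    by_contra hh
    have h5 := hanti (show (⟨2 * m + 2 - i, by omega⟩ : Fin n) ≤ v by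
      rw [Fin.le_def]; simp only; omega)
    have h6 := hv.2
    rw [hdg v] at h6
    omega
  have h7 := Finset.card_le_card h4
  have h8 : (Finset.univ.filter (fun v : Fin n => (v : ℕ) < 2 * m + 2 - i)).card
      ≤ (Finset.range (2 * m + 2 - i)).card := by
    apply Finset.card_le_card_of_injOn (fun v : Fin n => (v : ℕ))
    · intro v hv
      simpa using hv
    · intro a _ b _ hab
      exact Fin.ext hab
  rw [Finset.card_range] at h8
  omega
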